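/- Assume k₁/ρ₁ ≠ k₂/ρ₂. Then there exist NO data as in the resolvent-sequence setting with ℓ = 4: it is impossible to have a sequence (λₙ) of nonzero reals with |λₙ| → ∞ together with tuples Uₙ, Fₙ satisfying all the regularity assumptions, boundary conditions and resolvent equations of the setting with ℓ = 4, ‖Uₙ‖_H = 1 for all n, and ‖Fₙ‖_H → 0. (This is the frequency-domain criterion ‖(iλ − 𝒜)⁻¹‖ = O(λ⁴) underlying the polynomial energy decay rate t^{−1/2} of the Bresse system when k₁/ρ₁ ≠ k₂/ρ₂.) -/

import Mathlib

open Set Filter MeasureTheory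

noncomputable section

/-- The resolvent-sequence setting for the locally damped Bresse system with
parameter `ℓ`: a sequence of nonzero frequencies `lam n` with `|lam n| → ∞`,
solutions `Uₙ = (v1,…,v6)` and right-hand sides `Fₙ = (f1,…,f6)` of the resolvent
equations `(lam n)^ℓ (i (lam n) I − 𝒜) Uₙ = Fₙ`, with `‖Uₙ‖_H = 1` and `‖Fₙ‖_H → 0`. -/
structure BresseSetting (ρ₁ ρ₂ k₁ k₂ k₃ l L β a₀ : ℝ) (ℓ : ℕ) where
  lam : ℕ → ℝ
  v1 : ℕ → ℝ → ℂ
  v2 : ℕ → ℝ → ℂ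
  v3 : ℕ → ℝ → ℂ
  v4 : ℕ → ℝ → ℂ
  v5 : ℕ → ℝ → ℂ
  v6 : ℕ → ℝ → ℂ
  f1 : ℕ → ℝ → ℂ
  f2 : ℕ → ℝ → ℂ
  f3 : ℕ → ℝ → ℂ
  f4 : ℕ → ℝ → ℂ
  f5 : ℕ → ℝ → ℂ
  f6 : ℕ → ℝ → ℂ
  lam_ne : ∀ n, lam n ≠ 0
  lam_tendsto : Tendsto (fun n => |lam n|) atTop atTop
  reg_v1 : ∀ n, ContDiffOn ℝ 2 (v1 n) (Icc 0 L)
  reg_v3 : ∀ n, ContDiffOn ℝ 2 (v3 n) (Icc 0 L)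
  reg_v5 : ∀ n, ContDiffOn ℝ 1 (v5 n) (Icc 0 L)
  reg_v5_left : ∀ n, ContDiffOn ℝ 2 (v5 n) (Icc 0 β)
  reg_v5_right : ∀ n, ContDiffOn ℝ 2 (v5 n) (Icc β L)
  reg_v2 : ∀ n, ContDiffOn ℝ 1 (v2 n) (Icc 0 L)
  reg_v4 : ∀ n, ContDiffOn ℝ 1 (v4 n) (Icc 0 L)
  reg_v6 : ∀ n, ContDiffOn ℝ 1 (v6 n) (Icc 0 L)
  reg_f1 : ∀ n, ContDiffOn ℝ 1 (f1 n) (Icc 0 L)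
  reg_f3 : ∀ n, ContDiffOn ℝ 1 (f3 n) (Icc 0 L)
  reg_f5 : ∀ n, ContDiffOn ℝ 1 (f5 n) (Icc 0 L)
  reg_f2 : ∀ n, ContinuousOn (f2 n) (Icc 0 L)
  reg_f4 : ∀ n, ContinuousOn (f4 n) (Icc 0 L)
  reg_f6 : ∀ n, ContinuousOn (f6 n) (Icc 0 L)
  bc_zero : ∀ n, v1 n 0 = 0 ∧ v2 n 0 = 0 ∧ v3 n 0 = 0 ∧ v4 n 0 = 0 ∧ v5 n 0 = 0 ∧
      v6 n 0 = 0 ∧ f1 n 0 = 0 ∧ f3 n 0 = 0 ∧ f5 n 0 = 0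
  bc_L : ∀ n, v1 n L = 0 ∧ v2 n L = 0 ∧ v3 n L = 0 ∧ v4 n L = 0 ∧ v5 n L = 0 ∧
      v6 n L = 0 ∧ f1 n L = 0 ∧ f3 n L = 0 ∧ f5 n L = 0
  eq1 : ∀ n, ∀ x ∈ Ioo (0 : ℝ) β ∪ Ioo β L,
      Complex.I * (lam n : ℂ) * v1 n x - v2 n x = (lam n : ℂ) ^ (-(ℓ : ℤ)) * f1 n x
  eq2 : ∀ n, ∀ x ∈ Ioo (0 : ℝ) β ∪ Ioo β L,
      Complex.I * (lam n : ℂ) * (ρ₁ : ℂ) * v2 n x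
        - (k₁ : ℂ) * deriv (fun y => deriv (v1 n) y + v3 n y + (l : ℂ) * v5 n y) x
        - (l : ℂ) * (k₃ : ℂ) * (deriv (v5 n) x - (l : ℂ) * v1 n x)
        = (ρ₁ : ℂ) * (lam n : ℂ) ^ (-(ℓ : ℤ)) * f2 n x
  eq3 : ∀ n, ∀ x ∈ Ioo (0 : ℝ) β ∪ Ioo β L,
      Complex.I * (lam n : ℂ) * v3 n x - v4 n x = (lam n : ℂ) ^ (-(ℓ : ℤ)) * f3 n x
  eq4 : ∀ n, ∀ x ∈ Ioo (0 : ℝ) β ∪ Ioo β L,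
      Complex.I * (lam n : ℂ) * (ρ₂ : ℂ) * v4 n x
        - (k₂ : ℂ) * deriv (deriv (v3 n)) x
        + (k₁ : ℂ) * (deriv (v1 n) x + v3 n x + (l : ℂ) * v5 n x)
        = (ρ₂ : ℂ) * (lam n : ℂ) ^ (-(ℓ : ℤ)) * f4 n x
  eq5 : ∀ n, ∀ x ∈ Ioo (0 : ℝ) β ∪ Ioo β L,
      Complex.I * (lam n : ℂ) * v5 n x - v6 n x = (lam n : ℂ) ^ (-(ℓ : ℤ)) * f5 n x
  eq6 : ∀ n, ∀ x ∈ Ioo (0 : ℝ) β ∪ Ioo β L,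
      Complex.I * (lam n : ℂ) * (ρ₁ : ℂ) * v6 n x
        - (k₃ : ℂ) * deriv (fun y => deriv (v5 n) y - (l : ℂ) * v1 n y) x
        + (l : ℂ) * (k₁ : ℂ) * (deriv (v1 n) x + v3 n x + (l : ℂ) * v5 n x)
        + (if x < β then (a₀ : ℂ) else 0) * v6 n x
        = (ρ₁ : ℂ) * (lam n : ℂ) ^ (-(ℓ : ℤ)) * f6 n x
  normU : ∀ n, (∫ x in (0 : ℝ)..L,
      (k₁ * ‖deriv (v1 n) x + v3 n x + (l : ℂ) * v5 n x‖ ^ 2 + ρ₁ * ‖v2 n x‖ ^ 2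
        + k₂ * ‖deriv (v3 n) x‖ ^ 2 + ρ₂ * ‖v4 n x‖ ^ 2
        + k₃ * ‖deriv (v5 n) x - (l : ℂ) * v1 n x‖ ^ 2 + ρ₁ * ‖v6 n x‖ ^ 2)) = 1
  normF : Tendsto (fun n => ∫ x in (0 : ℝ)..L,
      (k₁ * ‖deriv (f1 n) x + f3 n x + (l : ℂ) * f5 n x‖ ^ 2 + ρ₁ * ‖f2 n x‖ ^ 2
        + k₂ * ‖deriv (f3 n) x‖ ^ 2 + ρ₂ * ‖f4 n x‖ ^ 2
        + k₃ * ‖deriv (f5 n) x - (l : ℂ) * f1 n x‖ ^ 2 + ρ₁ * ‖f6 n x‖ ^ 2))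
      atTop (nhds 0)


/-- Bounded in `L²(0,b)`. -/
def BdL2 (b : ℝ) (g : ℕ → ℝ → ℂ) : Prop :=
  (∀ n, ContinuousOn (g n) (Icc 0 b)) ∧ ∃ C : ℝ, ∀ n, ∫ x in (0 : ℝ)..b, ‖g n x‖ ^ 2 ≤ C

/-- Tending to zero in `L²(0,b)`. -/
def SmL2 (b : ℝ) (g : ℕ → ℝ → ℂ) : Prop :=
  (∀ n, ContinuousOn (g n) (Icc 0 b)) ∧
    Tendsto (fun n => ∫ x in (0 : ℝ)..b, ‖g n x‖ ^ 2) atTop (nhds 0)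

/-- Integral over `(0,b)` tending to zero. -/
def NulI (b : ℝ) (g : ℕ → ℝ → ℂ) : Prop :=
  (∀ n, ContinuousOn (g n) (Icc 0 b)) ∧
    Tendsto (fun n => ∫ x in (0 : ℝ)..b, g n x) atTop (nhds 0)

lemma ii_of_cont {E : Type*} [NormedAddCommGroup E] {b : ℝ} (hb : 0 < b) {f : ℝ → E}
    (h : ContinuousOn f (Icc 0 b)) : IntervalIntegrable f volume 0 b := by
  apply ContinuousOn.intervalIntegrable
  rwa [uIcc_of_le hb.le]

lemma cont_conj {s : Set ℝ} {f : ℝ → ℂ} (h : ContinuousOn f s) :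
    ContinuousOn (fun x => (starRingEnd ℂ) (f x)) s :=
  Complex.continuous_conj.comp_continuousOn h

lemma sq_int_nonneg {b : ℝ} (hb : 0 < b) (f : ℝ → ℂ) :
    0 ≤ ∫ x in (0 : ℝ)..b, ‖f x‖ ^ 2 :=
  intervalIntegral.integral_nonneg hb.le (fun x _ => by positivity)

lemma sq_int_mono {b : ℝ} (hb : 0 < b) {f g : ℝ → ℝ} (hf : ContinuousOn f (Icc 0 b))
    (hg : ContinuousOn g (Icc 0 b)) (h : ∀ x ∈ Icc 0 b, f x ≤ g x) :
    ∫ x in (0 : ℝ)..b, f x ≤ ∫ x in (0 : ℝ)..b, g x :=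
  intervalIntegral.integral_mono_on hb.le (ii_of_cont hb hf) (ii_of_cont hb hg) h

lemma sq_int_add {b : ℝ} (hb : 0 < b) {f g : ℝ → ℂ} (hf : ContinuousOn f (Icc 0 b))
    (hg : ContinuousOn g (Icc 0 b)) :
    ∫ x in (0 : ℝ)..b, ‖f x + g x‖ ^ 2 ≤
      2 * (∫ x in (0 : ℝ)..b, ‖f x‖ ^ 2) + 2 * ∫ x in (0 : ℝ)..b, ‖g x‖ ^ 2 := by
  rw [← intervalIntegral.integral_const_mul, ← intervalIntegral.integral_const_mul,
    ← intervalIntegral.integral_add]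
  · apply sq_int_mono hb (by fun_prop) (by fun_prop)
    intro x _
    have := norm_add_le (f x) (g x)
    nlinarith [norm_nonneg (f x + g x), sq_nonneg (‖f x‖ - ‖g x‖), norm_nonneg (f x),
      norm_nonneg (g x)]
  · exact ii_of_cont hb (by fun_prop)
  · exact ii_of_cont hb (by fun_prop)

lemma BdL2.add {b : ℝ} (hb : 0 < b) {g h : ℕ → ℝ → ℂ} (hg : BdL2 b g) (hh : BdL2 b h) :
    BdL2 b (fun n x => g n x + h n x) := by
  obtain ⟨hg1, C, hC⟩ := hg
  obtain ⟨hh1, D, hD⟩ := hh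
  refine ⟨fun n => (hg1 n).add (hh1 n), 2 * C + 2 * D, fun n => ?_⟩
  have := sq_int_add hb (hg1 n) (hh1 n)
  linarith [hC n, hD n]

lemma SmL2.add {b : ℝ} (hb : 0 < b) {g h : ℕ → ℝ → ℂ} (hg : SmL2 b g) (hh : SmL2 b h) :
    SmL2 b (fun n x => g n x + h n x) := by
  refine ⟨fun n => (hg.1 n).add (hh.1 n), ?_⟩
  have h0 := (hg.2.const_mul 2).add (hh.2.const_mul 2)
  simp only [mul_zero, add_zero] at h0
  exact squeeze_zero (fun n => sq_int_nonneg hb _) (fun n => sq_int_add hb (hg.1 n) (hh.1 n)) h0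

lemma SmL2.bd {b : ℝ} {g : ℕ → ℝ → ℂ} (hg : SmL2 b g) : BdL2 b g := by
  refine ⟨hg.1, ?_⟩
  obtain ⟨C, hC⟩ := hg.2.bddAbove_range
  exact ⟨C, fun n => hC ⟨n, rfl⟩⟩

lemma sq_int_smul {b : ℝ} (c : ℂ) (f : ℝ → ℂ) :
    ∫ x in (0 : ℝ)..b, ‖c * f x‖ ^ 2 = ‖c‖ ^ 2 * ∫ x in (0 : ℝ)..b, ‖f x‖ ^ 2 := by
  rw [← intervalIntegral.integral_const_mul]
  congr 1
  ext x
  rw [norm_mul, mul_pow]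

/-- bounded scalar sequence times bounded -/
lemma BdL2.smul {b : ℝ} (hb : 0 < b) {g : ℕ → ℝ → ℂ} (hg : BdL2 b g) (c : ℕ → ℂ) (K : ℝ)
    (hc : ∀ n, ‖c n‖ ≤ K) : BdL2 b (fun n x => c n * g n x) := by
  obtain ⟨hg1, C, hC⟩ := hg
  refine ⟨fun n => continuousOn_const.mul (hg1 n), K ^ 2 * C, fun n => ?_⟩
  rw [sq_int_smul]
  have h1 := sq_int_nonneg hb (g n)
  have h2 : ‖c n‖ ^ 2 ≤ K ^ 2 := by gcongr; exact hc n
  exact mul_le_mul h2 (hC n) h1 (by positivity)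

lemma SmL2.smul {b : ℝ} (hb : 0 < b) {g : ℕ → ℝ → ℂ} (hg : SmL2 b g) (c : ℕ → ℂ) (K : ℝ)
    (hc : ∀ n, ‖c n‖ ≤ K) : SmL2 b (fun n x => c n * g n x) := by
  refine ⟨fun n => continuousOn_const.mul (hg.1 n), ?_⟩
  have h0 := hg.2.const_mul (K ^ 2)
  rw [mul_zero] at h0
  refine squeeze_zero (fun n => sq_int_nonneg hb _) (fun n => ?_) h0
  rw [sq_int_smul]
  have h1 := sq_int_nonneg hb (g n)
  have h2 : ‖c n‖ ^ 2 ≤ K ^ 2 := by gcongr; exact hc n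
  exact mul_le_mul_of_nonneg_right h2 h1

/-- null scalar sequence times bounded -/
lemma BdL2.smul_null {b : ℝ} (hb : 0 < b) {g : ℕ → ℝ → ℂ} (hg : BdL2 b g) (c : ℕ → ℂ)
    (hc : Tendsto c atTop (nhds 0)) : SmL2 b (fun n x => c n * g n x) := by
  obtain ⟨hg1, C, hC⟩ := hg
  refine ⟨fun n => continuousOn_const.mul (hg1 n), ?_⟩
  have h0 : Tendsto (fun n => ‖c n‖ ^ 2 * C) atTop (nhds 0) := by
    have := ((hc.norm).pow 2).mul_const C
    simpa using this
  refine squeeze_zero (fun n => sq_int_nonneg hb _) (fun n => ?_) h0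
  rw [sq_int_smul]
  exact mul_le_mul_of_nonneg_left (hC n) (by positivity)

lemma sq_int_weight {b : ℝ} (hb : 0 < b) {φ : ℝ → ℂ} (hφ : Continuous φ) :
    ∃ K : ℝ, 0 ≤ K ∧ ∀ f : ℝ → ℂ, ContinuousOn f (Icc 0 b) →
      ∫ x in (0 : ℝ)..b, ‖φ x * f x‖ ^ 2 ≤ K * ∫ x in (0 : ℝ)..b, ‖f x‖ ^ 2 := by
  obtain ⟨C, hC⟩ := (isCompact_Icc (a := (0 : ℝ)) (b := b)).exists_bound_of_continuousOn
    hφ.continuousOn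
  refine ⟨C ^ 2, by positivity, fun f hf => ?_⟩
  rw [← intervalIntegral.integral_const_mul]
  apply sq_int_mono hb
  · exact ((hφ.continuousOn.mul hf).norm).pow 2
  · exact continuousOn_const.mul (hf.norm.pow 2)
  · intro x hx
    rw [norm_mul, mul_pow]
    have := hC x hx
    gcongr

lemma BdL2.weight {b : ℝ} (hb : 0 < b) {g : ℕ → ℝ → ℂ} (hg : BdL2 b g) (φ : ℝ → ℂ)
    (hφ : Continuous φ) : BdL2 b (fun n x => φ x * g n x) := by
  obtain ⟨hg1, C, hC⟩ := hg
  obtain ⟨K, hK0, hK⟩ := sq_int_weight hb hφ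
  refine ⟨fun n => hφ.continuousOn.mul (hg1 n), K * C, fun n => (hK _ (hg1 n)).trans ?_⟩
  exact mul_le_mul_of_nonneg_left (hC n) hK0

lemma SmL2.weight {b : ℝ} (hb : 0 < b) {g : ℕ → ℝ → ℂ} (hg : SmL2 b g) (φ : ℝ → ℂ)
    (hφ : Continuous φ) : SmL2 b (fun n x => φ x * g n x) := by
  obtain ⟨K, hK0, hK⟩ := sq_int_weight hb hφ
  refine ⟨fun n => hφ.continuousOn.mul (hg.1 n), ?_⟩
  have h0 := hg.2.const_mul K
  rw [mul_zero] at h0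
  exact squeeze_zero (fun n => sq_int_nonneg hb _) (fun n => hK _ (hg.1 n)) h0

lemma BdL2.conj {b : ℝ} {g : ℕ → ℝ → ℂ} (hg : BdL2 b g) :
    BdL2 b (fun n x => (starRingEnd ℂ) (g n x)) := by
  refine ⟨fun n => cont_conj (hg.1 n), ?_⟩
  simpa using hg.2

lemma SmL2.conj {b : ℝ} {g : ℕ → ℝ → ℂ} (hg : SmL2 b g) :
    SmL2 b (fun n x => (starRingEnd ℂ) (g n x)) := by
  refine ⟨fun n => cont_conj (hg.1 n), ?_⟩
  simpa using hg.2

/-- product of a null and a bounded sequence has null integral -/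
lemma SmL2.mul {b : ℝ} (hb : 0 < b) {g h : ℕ → ℝ → ℂ} (hg : SmL2 b g) (hh : BdL2 b h) :
    NulI b (fun n x => g n x * h n x) := by
  obtain ⟨hh1, C, hC⟩ := hh
  refine ⟨fun n => (hg.1 n).mul (hh1 n), ?_⟩
  rw [Metric.tendsto_atTop]
  intro e he
  have hC0 : 0 ≤ C := (sq_int_nonneg hb _).trans (hC 0)
  -- use |gh| ≤ |g|²/(2d) + d|h|²/2
  set d : ℝ := e / (C + 1) with hd
  have hd0 : 0 < d := by positivity
  obtain ⟨n0, hn0⟩ := (Metric.tendsto_atTop.mp hg.2) (d * e) (by positivity)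
  refine ⟨n0, fun n hn => ?_⟩
  have h1 := hn0 n hn
  rw [Real.dist_eq, sub_zero, abs_of_nonneg (sq_int_nonneg hb _)] at h1
  rw [dist_zero_right]
  have hgn := hg.1 n
  have hhn := hh1 n
  have h2 : ‖∫ x in (0 : ℝ)..b, g n x * h n x‖ ≤
      ∫ x in (0 : ℝ)..b, ((1 / (2 * d)) * ‖g n x‖ ^ 2 + (d / 2) * ‖h n x‖ ^ 2) := by
    refine (intervalIntegral.norm_integral_le_integral_norm hb.le).trans ?_
    apply sq_int_mono hb (by fun_prop) (by fun_prop)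
    intro x _
    rw [norm_mul]
    have : 0 ≤ (1 / (2 * d)) * (‖g n x‖ - d * ‖h n x‖) ^ 2 := by positivity
    have h3 : (1 / (2 * d)) * (‖g n x‖ - d * ‖h n x‖) ^ 2 =
      (1 / (2 * d)) * ‖g n x‖ ^ 2 + (d / 2) * ‖h n x‖ ^ 2 - ‖g n x‖ * ‖h n x‖ := by
      field_simp
      ring
    linarith
  rw [intervalIntegral.integral_add (ii_of_cont hb (by fun_prop)) (ii_of_cont hb (by fun_prop)),
    intervalIntegral.integral_const_mul, intervalIntegral.integral_const_mul] at h2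
  have h4 : (1 / (2 * d)) * (∫ x in (0 : ℝ)..b, ‖g n x‖ ^ 2) < e / 2 := by
    calc (1 / (2 * d)) * (∫ x in (0 : ℝ)..b, ‖g n x‖ ^ 2) < (1 / (2 * d)) * (d * e) := by gcongr
      _ = e / 2 := by field_simp
  have h5 : (d / 2) * (∫ x in (0 : ℝ)..b, ‖h n x‖ ^ 2) ≤ e / 2 := by
    calc (d / 2) * (∫ x in (0 : ℝ)..b, ‖h n x‖ ^ 2) ≤ (d / 2) * (C + 1) := by
          gcongr; linarith [hC n]
      _ = e / 2 := by rw [hd]; field_simp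
  linarith

lemma BdL2.mul {b : ℝ} (hb : 0 < b) {g h : ℕ → ℝ → ℂ} (hg : BdL2 b g) (hh : SmL2 b h) :
    NulI b (fun n x => g n x * h n x) := by
  simpa [mul_comm] using hh.mul hb hg

lemma NulI.add {b : ℝ} (hb : 0 < b) {g h : ℕ → ℝ → ℂ} (hg : NulI b g) (hh : NulI b h) :
    NulI b (fun n x => g n x + h n x) := by
  refine ⟨fun n => (hg.1 n).add (hh.1 n), ?_⟩
  have := hg.2.add hh.2
  rw [add_zero] at this
  refine this.congr fun n => ?_
  rw [intervalIntegral.integral_add (ii_of_cont hb (hg.1 n)) (ii_of_cont hb (hh.1 n))]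

lemma NulI.cmul {b : ℝ} {g : ℕ → ℝ → ℂ} (hg : NulI b g) (c : ℂ) :
    NulI b (fun n x => c * g n x) := by
  refine ⟨fun n => continuousOn_const.mul (hg.1 n), ?_⟩
  have := hg.2.const_mul c
  rw [mul_zero] at this
  refine this.congr fun n => ?_
  rw [intervalIntegral.integral_const_mul]

lemma NulI.smul {b : ℝ} {g : ℕ → ℝ → ℂ} (hg : NulI b g) (c : ℕ → ℂ) (K : ℝ)
    (hc : ∀ n, ‖c n‖ ≤ K) : NulI b (fun n x => c n * g n x) := by
  refine ⟨fun n => continuousOn_const.mul (hg.1 n), ?_⟩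
  have h0 := (hg.2.norm).const_mul K
  rw [norm_zero, mul_zero] at h0
  apply squeeze_zero_norm _ h0
  intro n
  rw [intervalIntegral.integral_const_mul, norm_mul]
  exact mul_le_mul_of_nonneg_right (hc n) (norm_nonneg _)

lemma NulI.congr {b : ℝ} {g h : ℕ → ℝ → ℂ} (hg : NulI b g) (e : ∀ n x, h n x = g n x) :
    NulI b h := by
  have : h = g := by ext n x; exact e n x
  rwa [this]

/-- total derivatives of functions vanishing at both ends have zero integral -/
lemma NulI.of_deriv {b : ℝ} (hb : 0 < b) {Q q : ℕ → ℝ → ℂ}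
    (hQ : ∀ n, ContinuousOn (Q n) (Icc 0 b)) (hq : ∀ n, ContinuousOn (q n) (Icc 0 b))
    (hd : ∀ n, ∀ x ∈ Ioo (0 : ℝ) b, HasDerivAt (Q n) (q n x) x)
    (h0 : ∀ n, Q n 0 = 0) (h1 : ∀ n, Q n b = 0) : NulI b q := by
  refine ⟨hq, ?_⟩
  have : ∀ n, ∫ x in (0 : ℝ)..b, q n x = 0 := fun n => by
    rw [intervalIntegral.integral_eq_sub_of_hasDerivAt_of_le hb.le (hQ n) (hd n)
      (ii_of_cont hb (hq n)), h0, h1, sub_zero]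
  simp [this]

/-- from null integral of `(φ g) conj (φ g)` to `L²` convergence. -/
lemma SmL2.of_nul {b : ℝ} {g : ℕ → ℝ → ℂ} (hg : ∀ n, ContinuousOn (g n) (Icc 0 b))
    (h : NulI b (fun n x => g n x * (starRingEnd ℂ) (g n x))) : SmL2 b g := by
  refine ⟨hg, ?_⟩
  have h2 := h.2.norm
  rw [norm_zero] at h2
  have h3 : Tendsto (fun n => ‖(((∫ x in (0 : ℝ)..b, ‖g n x‖ ^ 2 : ℝ)) : ℂ)‖) atTop (nhds 0) := by
    refine h2.congr fun n => ?_
    rw [← intervalIntegral.integral_ofReal]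
    congr 2
    ext x
    beta_reduce
    rw [Complex.mul_conj, Complex.normSq_eq_norm_sq]
  rw [tendsto_zero_iff_norm_tendsto_zero]
  simpa only [Complex.norm_real] using h3

/-- two-sided Gronwall estimate -/
lemma gronwall_piece {p q C : ℝ} (hpq : p < q) (hC : 0 ≤ C) {E E' D : ℝ → ℝ}
    (hE : ContinuousOn E (Icc p q)) (hD : ContinuousOn D (Icc p q))
    (hd : ∀ x ∈ Ioo p q, HasDerivAt E (E' x) x) (hD0 : ∀ x ∈ Icc p q, 0 ≤ D x)
    (hE0 : ∀ x ∈ Icc p q, 0 ≤ E x)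
    (hb : ∀ x ∈ Ioo p q, |E' x| ≤ C * E x + D x) (x y : ℝ) (hx : x ∈ Icc p q)
    (hy : y ∈ Icc p q) :
    E y ≤ Real.exp (C * (q - p)) * (E x + ∫ t in p..q, D t) := by
  have hDi : IntervalIntegrable D volume p q := by
    apply ContinuousOn.intervalIntegrable; rwa [uIcc_of_le hpq.le]
  have hDsub : ∀ s ∈ Icc p q, ∀ t ∈ Icc p q, IntervalIntegrable D volume s t := by
    intro s hs t ht
    apply ContinuousOn.intervalIntegrable
    exact hD.mono (uIcc_subset_Icc hs ht)
  set J : ℝ → ℝ := fun x => ∫ t in p..x, D t with hJ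
  have hJc : ContinuousOn J (Icc p q) := by
    have := intervalIntegral.continuousOn_primitive_interval' hDi left_mem_uIcc
    rwa [uIcc_of_le hpq.le] at this
  have hJd : ∀ x ∈ Ioo p q, HasDerivAt J (D x) x := by
    intro x hx
    apply intervalIntegral.integral_hasDerivAt_right
    · exact hDsub p ⟨le_rfl, hpq.le⟩ x ⟨hx.1.le, hx.2.le⟩
    · exact (hD.mono Ioo_subset_Icc_self).stronglyMeasurableAtFilter isOpen_Ioo x hx
    · exact hD.continuousAt (Icc_mem_nhds hx.1 hx.2)
  have hJp : J p = 0 := by simp [hJ]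
  have hJm : MonotoneOn J (Icc p q) := by
    apply monotoneOn_of_deriv_nonneg (convex_Icc p q) hJc
    · intro x hx
      rw [interior_Icc] at hx
      exact (hJd x hx).differentiableAt.differentiableWithinAt
    · intro x hx
      rw [interior_Icc] at hx
      rw [(hJd x hx).deriv]
      exact hD0 x ⟨hx.1.le, hx.2.le⟩
  have hJ0 : ∀ t ∈ Icc p q, 0 ≤ J t := fun t ht => by
    rw [← hJp]; exact hJm ⟨le_rfl, hpq.le⟩ ht ht.1
  have hJq : ∀ t ∈ Icc p q, J t ≤ J q := fun t ht => hJm ht ⟨hpq.le, le_rfl⟩ ht.2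
  -- forward
  have hexpd : ∀ (c x : ℝ), HasDerivAt (fun t => Real.exp (c * (t - p)))
      (Real.exp (c * (x - p)) * c) x := by
    intro c x
    have h1 : HasDerivAt (fun t : ℝ => c * (t - p)) c x := by
      simpa using ((hasDerivAt_id x).sub_const p).const_mul c
    exact h1.exp
  have hF : AntitoneOn (fun t => Real.exp (-C * (t - p)) * E t - J t) (Icc p q) := by
    apply antitoneOn_of_deriv_nonpos (convex_Icc p q)
    · exact ((by fun_prop : Continuous fun t : ℝ =>
        Real.exp (-C * (t - p))).continuousOn.mul hE).sub hJc
    · intro x hx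
      rw [interior_Icc] at hx
      exact (((hexpd _ x).mul (hd x hx)).sub (hJd x hx)).differentiableAt.differentiableWithinAt
    · intro x hx
      rw [interior_Icc] at hx
      have hxI : x ∈ Icc p q := ⟨hx.1.le, hx.2.le⟩
      have hder : HasDerivAt (fun t => Real.exp (-C * (t - p)) * E t - J t) _ x :=
        ((hexpd (-C) x).mul (hd x hx)).sub (hJd x hx)
      rw [hder.deriv]
      have h1 := (abs_le.mp (hb x hx)).2
      have h2 : Real.exp (-C * (x - p)) ≤ 1 := by
        apply Real.exp_le_one_iff.mpr
        nlinarith [hx.1]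
      have h3 := Real.exp_pos (-C * (x - p))
      have h4 := hD0 x hxI
      nlinarith
  have hG : MonotoneOn (fun t => Real.exp (C * (t - p)) * E t +
      Real.exp (C * (q - p)) * J t) (Icc p q) := by
    apply monotoneOn_of_deriv_nonneg (convex_Icc p q)
    · exact ((by fun_prop : Continuous fun t : ℝ =>
        Real.exp (C * (t - p))).continuousOn.mul hE).add (continuousOn_const.mul hJc)
    · intro x hx
      rw [interior_Icc] at hx
      exact (((hexpd _ x).mul (hd x hx)).add
        ((hJd x hx).const_mul _)).differentiableAt.differentiableWithinAt
    · intro x hx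
      rw [interior_Icc] at hx
      have hxI : x ∈ Icc p q := ⟨hx.1.le, hx.2.le⟩
      have hder : HasDerivAt (fun t => Real.exp (C * (t - p)) * E t +
          Real.exp (C * (q - p)) * J t) _ x :=
        ((hexpd C x).mul (hd x hx)).add ((hJd x hx).const_mul _)
      rw [hder.deriv]
      have h1 := (abs_le.mp (hb x hx)).1
      have h2 : Real.exp (C * (x - p)) ≤ Real.exp (C * (q - p)) := by
        apply Real.exp_le_exp.mpr
        nlinarith [hx.2]
      have h3 := Real.exp_pos (C * (x - p))
      have h4 := hD0 x hxI
      nlinarith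
  have hexp1 : ∀ t ∈ Icc p q, 1 ≤ Real.exp (C * (t - p)) := fun t ht =>
    Real.one_le_exp (by nlinarith [ht.1])
  have hexpq : ∀ t ∈ Icc p q, Real.exp (C * (t - p)) ≤ Real.exp (C * (q - p)) := fun t ht =>
    Real.exp_le_exp.mpr (by nlinarith [ht.2])
  change E y ≤ Real.exp (C * (q - p)) * (E x + J q)
  rcases le_total x y with hxy | hxy
  · have h := hF hx hy hxy
    simp only at h
    have h5 : Real.exp (C * (y - p)) * Real.exp (-C * (y - p)) = 1 := by
      rw [← Real.exp_add]; simp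
    have h6 : Real.exp (-C * (x - p)) ≤ 1 := Real.exp_le_one_iff.mpr (by nlinarith [hx.1])
    have h7 : Real.exp (-C * (y - p)) * E y ≤ E x + J q := by
      have := mul_le_mul_of_nonneg_right h6 (hE0 x hx)
      linarith [hJ0 x hx, hJq y hy]
    calc E y = Real.exp (C * (y - p)) * (Real.exp (-C * (y - p)) * E y) := by
          rw [← mul_assoc, h5, one_mul]
      _ ≤ Real.exp (C * (y - p)) * (E x + J q) := by gcongr
      _ ≤ Real.exp (C * (q - p)) * (E x + J q) := by
          apply mul_le_mul_of_nonneg_right (hexpq y hy)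
          linarith [hE0 x hx, hJ0 q ⟨hpq.le, le_rfl⟩]
  · have h := hG hy hx hxy
    simp only at h
    have h5 : E y ≤ Real.exp (C * (y - p)) * E y := by
      nlinarith [hexp1 y hy, hE0 y hy]
    have h6 : Real.exp (C * (x - p)) * E x ≤ Real.exp (C * (q - p)) * E x :=
      mul_le_mul_of_nonneg_right (hexpq x hx) (hE0 x hx)
    have h7 := Real.exp_pos (C * (q - p))
    have h8 : Real.exp (C * (q - p)) * J x ≤ Real.exp (C * (q - p)) * J q :=
      mul_le_mul_of_nonneg_left (hJq x hx) h7.le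
    have h9 : 0 ≤ Real.exp (C * (q - p)) * J y := mul_nonneg h7.le (hJ0 y hy)
    linarith


/-- First-order form of the resolvent system. -/
structure BSys (ρ₁ ρ₂ k₁ k₂ k₃ l L β a₀ : ℝ) where
  lam : ℕ → ℝ
  y1 : ℕ → ℝ → ℂ
  y2 : ℕ → ℝ → ℂ
  y3 : ℕ → ℝ → ℂ
  S : ℕ → ℝ → ℂ
  P : ℕ → ℝ → ℂ
  N : ℕ → ℝ → ℂ
  G1 : ℕ → ℝ → ℂ
  G2 : ℕ → ℝ → ℂ
  G3 : ℕ → ℝ → ℂ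
  G4 : ℕ → ℝ → ℂ
  G5 : ℕ → ℝ → ℂ
  G6 : ℕ → ℝ → ℂ
  lam_one : ∀ n, 1 ≤ |lam n|
  lam_tendsto : Tendsto (fun n => |lam n|) atTop atTop
  c_y1 : ∀ n, ContinuousOn (y1 n) (Icc 0 L)
  c_y2 : ∀ n, ContinuousOn (y2 n) (Icc 0 L)
  c_y3 : ∀ n, ContinuousOn (y3 n) (Icc 0 L)
  c_S : ∀ n, ContinuousOn (S n) (Icc 0 L)
  c_P : ∀ n, ContinuousOn (P n) (Icc 0 L)
  c_N : ∀ n, ContinuousOn (N n) (Icc 0 L)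
  c_G1 : ∀ n, ContinuousOn (G1 n) (Icc 0 L)
  c_G2 : ∀ n, ContinuousOn (G2 n) (Icc 0 L)
  c_G3 : ∀ n, ContinuousOn (G3 n) (Icc 0 L)
  c_G4 : ∀ n, ContinuousOn (G4 n) (Icc 0 L)
  c_G5 : ∀ n, ContinuousOn (G5 n) (Icc 0 L)
  c_G6 : ∀ n, ContinuousOn (G6 n) (Icc 0 L)
  d_y1 : ∀ n, ∀ x ∈ Ioo (0 : ℝ) β ∪ Ioo β L, HasDerivAt (y1 n)
    (Complex.I * lam n * S n x - y2 n x - l * y3 n x - (lam n : ℂ)⁻¹ ^ 4 * G1 n x) x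
  d_y2 : ∀ n, ∀ x ∈ Ioo (0 : ℝ) β ∪ Ioo β L, HasDerivAt (y2 n)
    (Complex.I * lam n * P n x - (lam n : ℂ)⁻¹ ^ 4 * G3 n x) x
  d_y3 : ∀ n, ∀ x ∈ Ioo (0 : ℝ) β ∪ Ioo β L, HasDerivAt (y3 n)
    (Complex.I * lam n * N n x + l * y1 n x - (lam n : ℂ)⁻¹ ^ 4 * G5 n x) x
  d_S : ∀ n, ∀ x ∈ Ioo (0 : ℝ) β ∪ Ioo β L, HasDerivAt (S n)
    ((Complex.I * lam n * ρ₁ * y1 n x - l * k₃ * N n x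
      - ρ₁ * (lam n : ℂ)⁻¹ ^ 4 * G2 n x) / k₁) x
  d_P : ∀ n, ∀ x ∈ Ioo (0 : ℝ) β ∪ Ioo β L, HasDerivAt (P n)
    ((Complex.I * lam n * ρ₂ * y2 n x + k₁ * S n x
      - ρ₂ * (lam n : ℂ)⁻¹ ^ 4 * G4 n x) / k₂) x
  d_N : ∀ n, ∀ x ∈ Ioo (0 : ℝ) β ∪ Ioo β L, HasDerivAt (N n)
    ((Complex.I * lam n * ρ₁ * y3 n x + l * k₁ * S n x
      + (if x < β then (a₀ : ℂ) else 0) * y3 n x - ρ₁ * (lam n : ℂ)⁻¹ ^ 4 * G6 n x) / k₃) x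
  bc0 : ∀ n, y1 n 0 = 0 ∧ y2 n 0 = 0 ∧ y3 n 0 = 0
  bcL : ∀ n, y1 n L = 0 ∧ y2 n L = 0 ∧ y3 n L = 0
  normU : ∀ n, (∫ x in (0 : ℝ)..L,
      (k₁ * ‖S n x‖ ^ 2 + ρ₁ * ‖y1 n x‖ ^ 2 + k₂ * ‖P n x‖ ^ 2 + ρ₂ * ‖y2 n x‖ ^ 2
        + k₃ * ‖N n x‖ ^ 2 + ρ₁ * ‖y3 n x‖ ^ 2)) = 1
  normF : Tendsto (fun n => ∫ x in (0 : ℝ)..L,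
      (k₁ * ‖G1 n x‖ ^ 2 + ρ₁ * ‖G2 n x‖ ^ 2 + k₂ * ‖G3 n x‖ ^ 2 + ρ₂ * ‖G4 n x‖ ^ 2
        + k₃ * ‖G5 n x‖ ^ 2 + ρ₁ * ‖G6 n x‖ ^ 2)) atTop (nhds 0)

lemma sq_int_restrict {b L : ℝ} (hb : 0 < b) (hbL : b ≤ L) {f : ℝ → ℂ}
    (hf : ContinuousOn f (Icc 0 L)) :
    ∫ x in (0 : ℝ)..b, ‖f x‖ ^ 2 ≤ ∫ x in (0 : ℝ)..L, ‖f x‖ ^ 2 := by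
  apply intervalIntegral.integral_mono_interval le_rfl hb.le hbL
  · exact Filter.Eventually.of_forall fun x => by positivity
  · exact ii_of_cont (hb.trans_le hbL) (hf.norm.pow 2)

lemma BdL2.restrict {b L : ℝ} (hb : 0 < b) (hbL : b ≤ L) {g : ℕ → ℝ → ℂ} (hg : BdL2 L g) :
    BdL2 b g := by
  obtain ⟨hg1, C, hC⟩ := hg
  exact ⟨fun n => (hg1 n).mono (Icc_subset_Icc_right hbL), C, fun n =>
    (sq_int_restrict hb hbL (hg1 n)).trans (hC n)⟩

lemma SmL2.restrict {b L : ℝ} (hb : 0 < b) (hbL : b ≤ L) {g : ℕ → ℝ → ℂ} (hg : SmL2 L g) :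
    SmL2 b g :=
  ⟨fun n => (hg.1 n).mono (Icc_subset_Icc_right hbL), squeeze_zero (fun _ => sq_int_nonneg hb _)
    (fun n => sq_int_restrict hb hbL (hg.1 n)) hg.2⟩

lemma hd_conj {f : ℝ → ℂ} {f' : ℂ} {x : ℝ} (h : HasDerivAt f f' x) :
    HasDerivAt (fun t => (starRingEnd ℂ) (f t)) ((starRingEnd ℂ) f') x := h.star

lemma sq_int_dom {L c : ℝ} (hL : 0 < L) (hc : 0 < c) {g : ℝ → ℂ} {d : ℝ → ℝ}
    (hg : ContinuousOn g (Icc 0 L)) (hd : ContinuousOn d (Icc 0 L))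
    (h : ∀ x ∈ Icc 0 L, c * ‖g x‖ ^ 2 ≤ d x) :
    ∫ x in (0 : ℝ)..L, ‖g x‖ ^ 2 ≤ c⁻¹ * ∫ x in (0 : ℝ)..L, d x := by
  rw [← intervalIntegral.integral_const_mul]
  apply sq_int_mono hL (hg.norm.pow 2) (continuousOn_const.mul hd)
  intro x hx
  change ‖g x‖ ^ 2 ≤ c⁻¹ * d x
  rw [inv_mul_eq_div, le_div_iff₀ hc, mul_comm]
  exact h x hx

namespace BSys

variable {ρ₁ ρ₂ k₁ k₂ k₃ l L β a₀ : ℝ} (s : BSys ρ₁ ρ₂ k₁ k₂ k₃ l L β a₀)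

/-- positivity assumptions -/
structure Pos (ρ₁ ρ₂ k₁ k₂ k₃ l L β a₀ : ℝ) : Prop where
  r1 : 0 < ρ₁
  r2 : 0 < ρ₂
  k1 : 0 < k₁
  k2 : 0 < k₂
  k3 : 0 < k₃
  pl : 0 < l
  pL : 0 < L
  a : 0 < a₀
  b : 0 < β
  bL : β < L

/-- inverse frequency -/
def nu (n : ℕ) : ℂ := (s.lam n : ℂ)⁻¹

def dens (n : ℕ) (x : ℝ) : ℝ :=
  k₁ * ‖s.S n x‖ ^ 2 + ρ₁ * ‖s.y1 n x‖ ^ 2 + k₂ * ‖s.P n x‖ ^ 2 + ρ₂ * ‖s.y2 n x‖ ^ 2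
        + k₃ * ‖s.N n x‖ ^ 2 + ρ₁ * ‖s.y3 n x‖ ^ 2

def densF (n : ℕ) (x : ℝ) : ℝ :=
  k₁ * ‖s.G1 n x‖ ^ 2 + ρ₁ * ‖s.G2 n x‖ ^ 2 + k₂ * ‖s.G3 n x‖ ^ 2 + ρ₂ * ‖s.G4 n x‖ ^ 2
        + k₃ * ‖s.G5 n x‖ ^ 2 + ρ₁ * ‖s.G6 n x‖ ^ 2

lemma cont_dens (n : ℕ) : ContinuousOn (s.dens n) (Icc 0 L) := by
  have h1 := s.c_y1 n
  have h2 := s.c_y2 n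
  have h3 := s.c_y3 n
  have h4 := s.c_S n
  have h5 := s.c_P n
  have h6 := s.c_N n
  unfold dens
  fun_prop

lemma cont_densF (n : ℕ) : ContinuousOn (s.densF n) (Icc 0 L) := by
  have h1 := s.c_G1 n
  have h2 := s.c_G2 n
  have h3 := s.c_G3 n
  have h4 := s.c_G4 n
  have h5 := s.c_G5 n
  have h6 := s.c_G6 n
  unfold densF
  fun_prop

lemma lam_ne (n : ℕ) : (s.lam n : ℂ) ≠ 0 := by
  have := s.lam_one n
  intro h
  have h2 : s.lam n = 0 := by exact_mod_cast h
  rw [h2] at this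
  norm_num at this

lemma nu_le (n : ℕ) : ‖s.nu n‖ ≤ 1 := by
  unfold nu
  rw [norm_inv, Complex.norm_real, Real.norm_eq_abs]
  exact inv_le_one_of_one_le₀ (s.lam_one n)

lemma nu_tendsto : Tendsto s.nu atTop (nhds 0) := by
  rw [tendsto_zero_iff_norm_tendsto_zero]
  refine (tendsto_inv_atTop_zero.comp s.lam_tendsto).congr fun n => ?_
  simp [nu]

lemma bd_aux (h : Pos ρ₁ ρ₂ k₁ k₂ k₃ l L β a₀) {c : ℝ} (hc : 0 < c) {g : ℕ → ℝ → ℂ}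
    (hg : ∀ n, ContinuousOn (g n) (Icc 0 L))
    (hd : ∀ n x, c * ‖g n x‖ ^ 2 ≤ s.dens n x) : BdL2 L g := by
  refine ⟨hg, c⁻¹, fun n => ?_⟩
  have := sq_int_dom h.pL hc (hg n) (s.cont_dens n) (fun x _ => hd n x)
  unfold dens at this
  rwa [s.normU n, mul_one] at this

lemma sm_aux (h : Pos ρ₁ ρ₂ k₁ k₂ k₃ l L β a₀) {c : ℝ} (hc : 0 < c) {g : ℕ → ℝ → ℂ}
    (hg : ∀ n, ContinuousOn (g n) (Icc 0 L))
    (hd : ∀ n x, c * ‖g n x‖ ^ 2 ≤ s.densF n x) : SmL2 L g := by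
  refine ⟨hg, ?_⟩
  have h0 := s.normF.const_mul c⁻¹
  rw [mul_zero] at h0
  exact squeeze_zero (fun n => sq_int_nonneg h.pL _)
    (fun n => sq_int_dom h.pL hc (hg n) (s.cont_densF n) (fun x _ => hd n x)) h0

/-- all the basic bounds on `(0,L)` -/
lemma bounds (h : Pos ρ₁ ρ₂ k₁ k₂ k₃ l L β a₀) :
    BdL2 L s.y1 ∧ BdL2 L s.y2 ∧ BdL2 L s.y3 ∧ BdL2 L s.S ∧ BdL2 L s.P ∧ BdL2 L s.N := by
  obtain ⟨h1, h2, h3, h4, h5, h6, h7, h8, h9, h10⟩ := h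
  have h : Pos ρ₁ ρ₂ k₁ k₂ k₃ l L β a₀ := ⟨h1, h2, h3, h4, h5, h6, h7, h8, h9, h10⟩
  refine ⟨s.bd_aux h h1 s.c_y1 ?_, s.bd_aux h h2 s.c_y2 ?_, s.bd_aux h h1 s.c_y3 ?_,
    s.bd_aux h h3 s.c_S ?_, s.bd_aux h h4 s.c_P ?_, s.bd_aux h h5 s.c_N ?_⟩ <;>
  · intro n x
    unfold dens
    have e1 : 0 ≤ k₁ * ‖s.S n x‖ ^ 2 := by positivity
    have e2 : 0 ≤ ρ₁ * ‖s.y1 n x‖ ^ 2 := by positivity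
    have e3 : 0 ≤ k₂ * ‖s.P n x‖ ^ 2 := by positivity
    have e4 : 0 ≤ ρ₂ * ‖s.y2 n x‖ ^ 2 := by positivity
    have e5 : 0 ≤ k₃ * ‖s.N n x‖ ^ 2 := by positivity
    have e6 : 0 ≤ ρ₁ * ‖s.y3 n x‖ ^ 2 := by positivity
    linarith

lemma smalls (h : Pos ρ₁ ρ₂ k₁ k₂ k₃ l L β a₀) :
    SmL2 L s.G1 ∧ SmL2 L s.G2 ∧ SmL2 L s.G3 ∧ SmL2 L s.G4 ∧ SmL2 L s.G5 ∧ SmL2 L s.G6 := by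
  obtain ⟨h1, h2, h3, h4, h5, h6, h7, h8, h9, h10⟩ := h
  have h : Pos ρ₁ ρ₂ k₁ k₂ k₃ l L β a₀ := ⟨h1, h2, h3, h4, h5, h6, h7, h8, h9, h10⟩
  refine ⟨s.sm_aux h h3 s.c_G1 ?_, s.sm_aux h h1 s.c_G2 ?_, s.sm_aux h h4 s.c_G3 ?_,
    s.sm_aux h h2 s.c_G4 ?_, s.sm_aux h h5 s.c_G5 ?_, s.sm_aux h h1 s.c_G6 ?_⟩ <;>
  · intro n x
    unfold densF
    have e1 : 0 ≤ k₁ * ‖s.G1 n x‖ ^ 2 := by positivity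
    have e2 : 0 ≤ ρ₁ * ‖s.G2 n x‖ ^ 2 := by positivity
    have e3 : 0 ≤ k₂ * ‖s.G3 n x‖ ^ 2 := by positivity
    have e4 : 0 ≤ ρ₂ * ‖s.G4 n x‖ ^ 2 := by positivity
    have e5 : 0 ≤ k₃ * ‖s.G5 n x‖ ^ 2 := by positivity
    have e6 : 0 ≤ ρ₁ * ‖s.G6 n x‖ ^ 2 := by positivity
    linarith

/-- the energy pairing of `F` and `U` -/
def T (n : ℕ) (x : ℝ) : ℂ :=
  k₁ * (s.S n x * (starRingEnd ℂ) (s.G1 n x)) + ρ₁ * (s.G2 n x * (starRingEnd ℂ) (s.y1 n x))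
  + k₂ * (s.P n x * (starRingEnd ℂ) (s.G3 n x)) + ρ₂ * (s.G4 n x * (starRingEnd ℂ) (s.y2 n x))
  + k₃ * (s.N n x * (starRingEnd ℂ) (s.G5 n x)) + ρ₁ * (s.G6 n x * (starRingEnd ℂ) (s.y3 n x))

lemma nul_T (h : Pos ρ₁ ρ₂ k₁ k₂ k₃ l L β a₀) : NulI L s.T := by
  obtain ⟨b1, b2, b3, b4, b5, b6⟩ := s.bounds h
  obtain ⟨g1, g2, g3, g4, g5, g6⟩ := s.smalls h
  exact ((((((b4.mul h.pL g1.conj).cmul k₁).add h.pL ((g2.mul h.pL b1.conj).cmul ρ₁)).add h.pL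
    ((b5.mul h.pL g3.conj).cmul k₂)).add h.pL ((g4.mul h.pL b2.conj).cmul ρ₂)).add h.pL
    ((b6.mul h.pL g5.conj).cmul k₃)).add h.pL ((g6.mul h.pL b3.conj).cmul ρ₁)

/-- the energy flux -/
def flux (n : ℕ) (x : ℝ) : ℂ :=
  k₁ * (s.S n x * (starRingEnd ℂ) (s.y1 n x)) + k₂ * (s.P n x * (starRingEnd ℂ) (s.y2 n x))
  + k₃ * (s.N n x * (starRingEnd ℂ) (s.y3 n x))

lemma d_flux (h : Pos ρ₁ ρ₂ k₁ k₂ k₃ l L β a₀) (n : ℕ) (x : ℝ)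
    (hx : x ∈ Ioo (0 : ℝ) β ∪ Ioo β L) :
    HasDerivAt (fun t => (s.flux n t).re)
      ((if x < β then a₀ else 0) * ‖s.y3 n x‖ ^ 2 - (s.lam n)⁻¹ ^ 4 * (s.T n x).re) x := by
  have h1 := s.d_y1 n x hx
  have h2 := s.d_y2 n x hx
  have h3 := s.d_y3 n x hx
  have h4 := s.d_S n x hx
  have h5 := s.d_P n x hx
  have h6 := s.d_N n x hx
  have hlam := s.lam_ne n
  have hk1 : (k₁ : ℂ) ≠ 0 := by exact_mod_cast h.k1.ne'
  have hk2 : (k₂ : ℂ) ≠ 0 := by exact_mod_cast h.k2.ne'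
  have hk3 : (k₃ : ℂ) ≠ 0 := by exact_mod_cast h.k3.ne'
  have hQ : HasDerivAt (s.flux n) _ x :=
    (((h4.mul (hd_conj h1)).const_mul (k₁ : ℂ)).add
      ((h5.mul (hd_conj h2)).const_mul (k₂ : ℂ))).add
      ((h6.mul (hd_conj h3)).const_mul (k₃ : ℂ))
  have hre := Complex.reCLM.hasFDerivAt.comp_hasDerivAt x hQ
  refine HasDerivAt.congr_deriv (f := fun t => (s.flux n t).re) hre ?_
  generalize ha : (if x < β then (a₀ : ℂ) else 0) = a
  have ha' : ((if x < β then a₀ else 0 : ℝ) : ℂ) = a := by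
    rw [← ha]; split_ifs <;> simp
  generalize (if x < β then a₀ else 0 : ℝ) = a' at ha'
  subst ha'
  unfold T
  have key : ∀ c : ℂ, Complex.reCLM c = c.re := fun _ => rfl
  rw [key]
  have e : ∀ z : ℂ, z * (starRingEnd ℂ) z = ((‖z‖ ^ 2 : ℝ) : ℂ) := fun z => by
    rw [Complex.mul_conj, Complex.normSq_eq_norm_sq]
  have e1 := e (s.y1 n x)
  have e2 := e (s.y2 n x)
  have e3 := e (s.y3 n x)
  have e4 := e (s.S n x)
  have e5 := e (s.P n x)
  have e6 := e (s.N n x)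
  set R : ℝ := s.lam n * (ρ₁ * ‖s.y1 n x‖ ^ 2 + ρ₂ * ‖s.y2 n x‖ ^ 2 + ρ₁ * ‖s.y3 n x‖ ^ 2
    - k₁ * ‖s.S n x‖ ^ 2 - k₂ * ‖s.P n x‖ ^ 2 - k₃ * ‖s.N n x‖ ^ 2) with hR
  have main : ∀ A B : ℂ, A = Complex.I * (R : ℂ) + ((a' * ‖s.y3 n x‖ ^ 2 : ℝ) : ℂ)
      - (((s.lam n)⁻¹ ^ 4 : ℝ) : ℂ) * B →
      A.re = a' * ‖s.y3 n x‖ ^ 2 - (s.lam n)⁻¹ ^ 4 * B.re := by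
    intro A B hAB
    rw [hAB, Complex.sub_re, Complex.add_re, Complex.re_ofReal_mul, Complex.ofReal_re]
    simp
  apply main
  simp only [hR, map_sub, map_add, map_mul, map_div₀, map_pow, map_inv₀, Complex.conj_I,
    Complex.conj_ofReal, Complex.ofReal_sub, Complex.ofReal_add, Complex.ofReal_mul, ← e1, ← e2,
    ← e3, ← e4, ← e5, ← e6, Complex.ofReal_inv]
  rw [Complex.ofReal_pow, Complex.ofReal_inv]
  field_simp
  ring

lemma cont_flux (n : ℕ) : ContinuousOn (fun t => (s.flux n t).re) (Icc 0 L) := by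
  have h1 := cont_conj (s.c_y1 n)
  have h2 := cont_conj (s.c_y2 n)
  have h3 := cont_conj (s.c_y3 n)
  have h4 := s.c_S n
  have h5 := s.c_P n
  have h6 := s.c_N n
  apply Complex.continuous_re.comp_continuousOn
  unfold flux
  fun_prop

lemma dissip (h : Pos ρ₁ ρ₂ k₁ k₂ k₃ l L β a₀) (n : ℕ) :
    a₀ * ∫ x in (0 : ℝ)..β, ‖s.y3 n x‖ ^ 2 =
      (s.lam n)⁻¹ ^ 4 * (∫ x in (0 : ℝ)..L, s.T n x).re := by
  have hTc : ContinuousOn (fun x => (s.T n x).re) (Icc 0 L) :=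
    Complex.continuous_re.comp_continuousOn ((s.nul_T h).1 n)
  have hyc : ContinuousOn (fun x => ‖s.y3 n x‖ ^ 2) (Icc 0 L) := (s.c_y3 n).norm.pow 2
  have hb0 := h.b
  have hbL := h.bL
  have hTi : ∀ p ∈ Icc 0 L, ∀ q ∈ Icc 0 L,
      IntervalIntegrable (fun x => (s.T n x).re) volume p q := fun p hp q hq =>
    (hTc.mono (uIcc_subset_Icc hp hq)).intervalIntegrable
  have m0 : (0 : ℝ) ∈ Icc 0 L := ⟨le_rfl, h.pL.le⟩
  have mb : β ∈ Icc 0 L := ⟨hb0.le, hbL.le⟩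
  have mL : L ∈ Icc 0 L := ⟨h.pL.le, le_rfl⟩
  have hyi : IntervalIntegrable (fun x => ‖s.y3 n x‖ ^ 2) volume 0 β :=
    (hyc.mono (uIcc_subset_Icc m0 mb)).intervalIntegrable
  have i1 : ∫ x in (0 : ℝ)..β, (a₀ * ‖s.y3 n x‖ ^ 2 - (s.lam n)⁻¹ ^ 4 * (s.T n x).re) =
      (s.flux n β).re - (s.flux n 0).re := by
    apply intervalIntegral.integral_eq_sub_of_hasDerivAt_of_le hb0.le
      ((s.cont_flux n).mono (Icc_subset_Icc_right hbL.le))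
    · intro x hx
      have := s.d_flux h n x (Or.inl hx)
      rwa [if_pos hx.2] at this
    · exact (hyi.const_mul _).sub ((hTi 0 m0 β mb).const_mul _)
  have i2 : ∫ x in β..L, (-((s.lam n)⁻¹ ^ 4) * (s.T n x).re) =
      (s.flux n L).re - (s.flux n β).re := by
    apply intervalIntegral.integral_eq_sub_of_hasDerivAt_of_le hbL.le
      ((s.cont_flux n).mono (Icc_subset_Icc_left hb0.le))
    · intro x hx
      have := s.d_flux h n x (Or.inr hx)
      rw [if_neg (not_lt.mpr hx.1.le)] at this
      refine this.congr_deriv ?_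
      ring
    · exact ((hTi β mb L mL).const_mul _)
  have f0 : s.flux n 0 = 0 := by
    obtain ⟨e1, e2, e3⟩ := s.bc0 n
    simp [flux, e1, e2, e3]
  have fL : s.flux n L = 0 := by
    obtain ⟨e1, e2, e3⟩ := s.bcL n
    simp [flux, e1, e2, e3]
  rw [intervalIntegral.integral_sub (hyi.const_mul _) ((hTi 0 m0 β mb).const_mul _),
    intervalIntegral.integral_const_mul, intervalIntegral.integral_const_mul, f0] at i1
  rw [intervalIntegral.integral_const_mul, fL] at i2
  have i3 := intervalIntegral.integral_add_adjacent_intervals (hTi 0 m0 β mb) (hTi β mb L mL)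
  have i4 : ∫ x in (0 : ℝ)..L, (s.T n x).re = (∫ x in (0 : ℝ)..L, s.T n x).re := by
    have := Complex.reCLM.intervalIntegral_comp_comm (ii_of_cont h.pL ((s.nul_T h).1 n))
    simpa using this
  rw [← i4, ← i3]
  simp only [Complex.zero_re] at i1 i2
  linarith

/-- rescaled damped velocity -/
def Y (n : ℕ) (x : ℝ) : ℂ := (s.lam n : ℂ) ^ 2 * s.y3 n x

lemma sm_Y (h : Pos ρ₁ ρ₂ k₁ k₂ k₃ l L β a₀) : SmL2 β s.Y := by
  refine ⟨fun n => continuousOn_const.mul ((s.c_y3 n).mono (Icc_subset_Icc_right h.bL.le)), ?_⟩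
  have h0 : Tendsto (fun n => a₀⁻¹ * (∫ x in (0 : ℝ)..L, s.T n x).re) atTop (nhds 0) := by
    have := ((Complex.continuous_re.tendsto _).comp (s.nul_T h).2).const_mul a₀⁻¹
    simpa using this
  refine h0.congr fun n => ?_
  unfold Y
  rw [sq_int_smul]
  have h1 := s.dissip h n
  have ha := h.a.ne'
  have hl : s.lam n ≠ 0 := by
    have := s.lam_ne n
    exact_mod_cast this
  have h2 : ‖(s.lam n : ℂ) ^ 2‖ ^ 2 = s.lam n ^ 4 := by
    rw [norm_pow, Complex.norm_real, Real.norm_eq_abs, sq_abs]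
    ring
  rw [h2]
  have h3 : (∫ x in (0 : ℝ)..L, s.T n x).re = s.lam n ^ 4 * (a₀ *
      ∫ x in (0 : ℝ)..β, ‖s.y3 n x‖ ^ 2) := by
    rw [h1]; field_simp
  rw [h3]
  field_simp

end BSys


/-- `g'` is the derivative of `g` on `(0,b)`, both continuous up to the boundary. -/
def DerOn (b : ℝ) (g g' : ℕ → ℝ → ℂ) : Prop :=
  (∀ n, ContinuousOn (g n) (Icc 0 b)) ∧ (∀ n, ContinuousOn (g' n) (Icc 0 b)) ∧
    ∀ n, ∀ x ∈ Ioo (0 : ℝ) b, HasDerivAt (g n) (g' n x) x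

lemma DerOn.smul {b : ℝ} {g g' : ℕ → ℝ → ℂ} (h : DerOn b g g') (c : ℕ → ℂ) :
    DerOn b (fun n x => c n * g n x) (fun n x => c n * g' n x) :=
  ⟨fun n => continuousOn_const.mul (h.1 n), fun n => continuousOn_const.mul (h.2.1 n),
    fun n x hx => (h.2.2 n x hx).const_mul (c n)⟩

lemma DerOn.nul {b : ℝ} (hb : 0 < b) {g g' k k' : ℕ → ℝ → ℂ} (hg : DerOn b g g')
    (hk : DerOn b k k') {φ phd : ℝ → ℂ} (hφ : Continuous φ) (hphd : Continuous phd)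
    (hd : ∀ x, HasDerivAt φ (phd x) x) (h0 : φ 0 = 0) (h1 : φ b = 0) :
    NulI b (fun n x => phd x * (g n x * (starRingEnd ℂ) (k n x)) +
      φ x * (g' n x * (starRingEnd ℂ) (k n x) + g n x * (starRingEnd ℂ) (k' n x))) := by
  apply NulI.of_deriv hb (Q := fun n x => φ x * (g n x * (starRingEnd ℂ) (k n x)))
  · intro n
    exact hφ.continuousOn.mul ((hg.1 n).mul (cont_conj (hk.1 n)))
  · intro n
    exact (hphd.continuousOn.mul ((hg.1 n).mul (cont_conj (hk.1 n)))).add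
      (hφ.continuousOn.mul (((hg.2.1 n).mul (cont_conj (hk.1 n))).add
        ((hg.1 n).mul (cont_conj (hk.2.1 n)))))
  · intro n x hx
    exact (hd x).mul ((hg.2.2 n x hx).mul (hd_conj (hk.2.2 n x hx)))
  · intro n; simp [h0]
  · intro n; simp [h1]

lemma NulI.of_cmul {b : ℝ} {g : ℕ → ℝ → ℂ} (c : ℂ) (hc : c ≠ 0)
    (hg : NulI b (fun n x => c * g n x)) : NulI b g :=
  (hg.cmul c⁻¹).congr fun n x => by field_simp

/-- cut-off -/
def qf (b : ℝ) (x : ℝ) : ℂ := (x : ℂ) * ((b : ℂ) - x)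
def qd (b : ℝ) (x : ℝ) : ℂ := (b : ℂ) - 2 * x

lemma cont_qf (b : ℝ) : Continuous (qf b) := by unfold qf; fun_prop
lemma cont_qd (b : ℝ) : Continuous (qd b) := by unfold qd; fun_prop

lemma ofReal_hd (x : ℝ) : HasDerivAt (fun t : ℝ => (t : ℂ)) 1 x :=
  (hasDerivAt_id x).ofReal_comp

lemma hd_qf (b x : ℝ) : HasDerivAt (qf b) (qd b x) x := by
  have h := (ofReal_hd x).mul ((ofReal_hd x).const_sub (b : ℂ))
  refine HasDerivAt.congr_deriv (f := qf b) h ?_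
  unfold qd
  ring

lemma hd_qd (b x : ℝ) : HasDerivAt (qd b) (-2) x := by
  have h := ((ofReal_hd x).const_mul (2 : ℂ)).const_sub (b : ℂ)
  refine HasDerivAt.congr_deriv (f := qd b) h ?_
  ring

lemma hd_eta (b x : ℝ) : HasDerivAt (fun t => qf b t ^ 2) (2 * qf b x * qd b x) x := by
  refine ((hd_qf b x).pow 2).congr_deriv ?_
  simp

lemma hd_eta' (b x : ℝ) : HasDerivAt (fun t => 2 * qf b t * qd b t)
    (2 * qd b x ^ 2 - 4 * qf b x) x := by
  refine (((hd_qf b x).const_mul 2).mul (hd_qd b x)).congr_deriv ?_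
  ring

lemma conj_qf (b x : ℝ) : (starRingEnd ℂ) (qf b x) = qf b x := by
  simp [qf]

lemma DerOn.nul_eta {b : ℝ} (hb : 0 < b) {g g' k k' : ℕ → ℝ → ℂ} (hg : DerOn b g g')
    (hk : DerOn b k k') :
    NulI b (fun n x => 2 * qf b x * qd b x * (g n x * (starRingEnd ℂ) (k n x)) +
      qf b x ^ 2 * (g' n x * (starRingEnd ℂ) (k n x) + g n x * (starRingEnd ℂ) (k' n x))) := by
  have h1 := cont_qf b
  have h2 := cont_qd b
  exact hg.nul hb hk (φ := fun x => qf b x ^ 2) (phd := fun x => 2 * qf b x * qd b x)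
    (by fun_prop) (by fun_prop) (hd_eta b) (by simp [qf]) (by simp [qf])

lemma DerOn.nul_eta' {b : ℝ} (hb : 0 < b) {g g' k k' : ℕ → ℝ → ℂ} (hg : DerOn b g g')
    (hk : DerOn b k k') :
    NulI b (fun n x => (2 * qd b x ^ 2 - 4 * qf b x) * (g n x * (starRingEnd ℂ) (k n x)) +
      2 * qf b x * qd b x *
        (g' n x * (starRingEnd ℂ) (k n x) + g n x * (starRingEnd ℂ) (k' n x))) := by
  have h1 := cont_qf b
  have h2 := cont_qd b
  exact hg.nul hb hk (φ := fun x => 2 * qf b x * qd b x)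
    (phd := fun x => 2 * qd b x ^ 2 - 4 * qf b x)
    (by fun_prop) (by fun_prop) (hd_eta' b) (by simp [qf]) (by simp [qf])

namespace BSys

variable {ρ₁ ρ₂ k₁ k₂ k₃ l L β a₀ : ℝ} (s : BSys ρ₁ ρ₂ k₁ k₂ k₃ l L β a₀)

lemma termS {g h : ℕ → ℝ → ℂ} (hb : 0 < β) (hg : SmL2 β g) (hh : BdL2 β h) (c : ℂ) (m : ℕ)
    (φ : ℝ → ℂ) (hφ : Continuous φ) :
    NulI β (fun n x => c * s.nu n ^ m * φ x * (g n x * h n x)) := by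
  have h1 := ((hg.weight hb φ hφ).mul hb hh).smul (fun n => c * s.nu n ^ m) ‖c‖ (fun n => by
    rw [norm_mul, norm_pow]
    exact mul_le_of_le_one_right (norm_nonneg _) (pow_le_one₀ (norm_nonneg _) (s.nu_le n)))
  exact h1.congr fun n x => by ring

lemma termB {g h : ℕ → ℝ → ℂ} (hb : 0 < β) (hg : BdL2 β g) (hh : BdL2 β h) (c : ℂ) (m : ℕ)
    (φ : ℝ → ℂ) (hφ : Continuous φ) :
    NulI β (fun n x => c * s.nu n ^ (m + 1) * φ x * (g n x * h n x)) :=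
  (s.termS hb (hg.smul_null hb s.nu s.nu_tendsto) hh c m φ hφ).congr fun n x => by ring

lemma smN {g : ℕ → ℝ → ℂ} (hb : 0 < β) (hg : SmL2 β g) (c : ℂ) (m : ℕ) :
    SmL2 β (fun n x => c * s.nu n ^ m * g n x) :=
  hg.smul hb (fun n => c * s.nu n ^ m) ‖c‖ (fun n => by
    rw [norm_mul, norm_pow]
    exact mul_le_of_le_one_right (norm_nonneg _) (pow_le_one₀ (norm_nonneg _) (s.nu_le n)))

lemma bdN {g : ℕ → ℝ → ℂ} (hb : 0 < β) (hg : BdL2 β g) (c : ℂ) (m : ℕ) :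
    BdL2 β (fun n x => c * s.nu n ^ m * g n x) :=
  hg.smul hb (fun n => c * s.nu n ^ m) ‖c‖ (fun n => by
    rw [norm_mul, norm_pow]
    exact mul_le_of_le_one_right (norm_nonneg _) (pow_le_one₀ (norm_nonneg _) (s.nu_le n)))

def dy1 (n : ℕ) (x : ℝ) : ℂ :=
  Complex.I * s.lam n * s.S n x - s.y2 n x - l * s.y3 n x - (s.lam n : ℂ)⁻¹ ^ 4 * s.G1 n x
def dy2 (n : ℕ) (x : ℝ) : ℂ :=
  Complex.I * s.lam n * s.P n x - (s.lam n : ℂ)⁻¹ ^ 4 * s.G3 n x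
def dy3 (n : ℕ) (x : ℝ) : ℂ :=
  Complex.I * s.lam n * s.N n x + l * s.y1 n x - (s.lam n : ℂ)⁻¹ ^ 4 * s.G5 n x
def dS (n : ℕ) (x : ℝ) : ℂ :=
  (Complex.I * s.lam n * ρ₁ * s.y1 n x - l * k₃ * s.N n x
      - ρ₁ * (s.lam n : ℂ)⁻¹ ^ 4 * s.G2 n x) / k₁
def dP (n : ℕ) (x : ℝ) : ℂ :=
  (Complex.I * s.lam n * ρ₂ * s.y2 n x + k₁ * s.S n x
      - ρ₂ * (s.lam n : ℂ)⁻¹ ^ 4 * s.G4 n x) / k₂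
def dN (n : ℕ) (x : ℝ) : ℂ :=
  (Complex.I * s.lam n * ρ₁ * s.y3 n x + l * k₁ * s.S n x
      + a₀ * s.y3 n x - ρ₁ * (s.lam n : ℂ)⁻¹ ^ 4 * s.G6 n x) / k₃
def Z (n : ℕ) (x : ℝ) : ℂ := Complex.I * s.lam n * s.N n x + l * s.y1 n x
def dZ (n : ℕ) (x : ℝ) : ℂ := Complex.I * s.lam n * s.dN n x + l * s.dy1 n x

lemma ders (h : Pos ρ₁ ρ₂ k₁ k₂ k₃ l L β a₀) :
    DerOn β s.y1 s.dy1 ∧ DerOn β s.y2 s.dy2 ∧ DerOn β s.y3 s.dy3 ∧ DerOn β s.S s.dS ∧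
    DerOn β s.P s.dP ∧ DerOn β s.Z s.dZ := by
  have hs : Icc 0 β ⊆ Icc 0 L := Icc_subset_Icc_right h.bL.le
  have c1 := fun n => (s.c_y1 n).mono hs
  have c2 := fun n => (s.c_y2 n).mono hs
  have c3 := fun n => (s.c_y3 n).mono hs
  have c4 := fun n => (s.c_S n).mono hs
  have c5 := fun n => (s.c_P n).mono hs
  have c6 := fun n => (s.c_N n).mono hs
  have g1 := fun n => (s.c_G1 n).mono hs
  have g2 := fun n => (s.c_G2 n).mono hs
  have g3 := fun n => (s.c_G3 n).mono hs
  have g4 := fun n => (s.c_G4 n).mono hs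
  have g5 := fun n => (s.c_G5 n).mono hs
  have g6 := fun n => (s.c_G6 n).mono hs
  have d1 : ∀ n, ContinuousOn (s.dy1 n) (Icc 0 β) := by
    intro n; have := c1 n; have := c2 n; have := c3 n; have := c4 n; have := g1 n
    unfold dy1; fun_prop
  have dN' : ∀ n, ContinuousOn (s.dN n) (Icc 0 β) := by
    intro n; have := c3 n; have := c4 n; have := g6 n
    unfold dN; fun_prop
  have hN : ∀ n, ∀ x ∈ Ioo (0 : ℝ) β, HasDerivAt (s.N n) (s.dN n x) x := by
    intro n x hx
    have := s.d_N n x (Or.inl hx)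
    rwa [if_pos hx.2] at this
  refine ⟨⟨c1, d1, fun n x hx => s.d_y1 n x (Or.inl hx)⟩,
    ⟨c2, ?_, fun n x hx => s.d_y2 n x (Or.inl hx)⟩,
    ⟨c3, ?_, fun n x hx => s.d_y3 n x (Or.inl hx)⟩,
    ⟨c4, ?_, fun n x hx => s.d_S n x (Or.inl hx)⟩,
    ⟨c5, ?_, fun n x hx => s.d_P n x (Or.inl hx)⟩,
    ⟨?_, ?_, fun n x hx => ((hN n x hx).const_mul _).add
      ((s.d_y1 n x (Or.inl hx)).const_mul _)⟩⟩
  · intro n; have := c5 n; have := g3 n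
    unfold dy2; fun_prop
  · intro n; have := c6 n; have := c1 n; have := g5 n
    unfold dy3; fun_prop
  · intro n; have := c6 n; have := c1 n; have := g2 n
    unfold dS; fun_prop
  · intro n; have := c2 n; have := c4 n; have := g4 n
    unfold dP; fun_prop
  · intro n; have := c6 n; have := c1 n
    unfold Z; fun_prop
  · intro n; have := dN' n; have := d1 n
    unfold dZ; fun_prop

/-- bounds and smallness on `(0,β)` -/
structure Facts : Prop where
  b1 : BdL2 β s.y1
  b2 : BdL2 β s.y2
  b3 : BdL2 β s.y3
  b4 : BdL2 β s.S
  b5 : BdL2 β s.P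
  b6 : BdL2 β s.N
  g1 : SmL2 β s.G1
  g2 : SmL2 β s.G2
  g3 : SmL2 β s.G3
  g4 : SmL2 β s.G4
  g5 : SmL2 β s.G5
  g6 : SmL2 β s.G6
  y : SmL2 β s.Y

lemma facts (h : Pos ρ₁ ρ₂ k₁ k₂ k₃ l L β a₀) : s.Facts := by
  obtain ⟨b1, b2, b3, b4, b5, b6⟩ := s.bounds h
  obtain ⟨g1, g2, g3, g4, g5, g6⟩ := s.smalls h
  have hb := h.b
  have hbL := h.bL.le
  exact ⟨b1.restrict hb hbL, b2.restrict hb hbL, b3.restrict hb hbL, b4.restrict hb hbL,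
    b5.restrict hb hbL, b6.restrict hb hbL, g1.restrict hb hbL, g2.restrict hb hbL,
    g3.restrict hb hbL, g4.restrict hb hbL, g5.restrict hb hbL, g6.restrict hb hbL, s.sm_Y h⟩

def z (n : ℕ) (x : ℝ) : ℂ := s.nu n * s.Z n x
def zd (n : ℕ) (x : ℝ) : ℂ := s.nu n * s.dZ n x
def sd (n : ℕ) (x : ℝ) : ℂ := s.nu n * s.dS n x
def pd (n : ℕ) (x : ℝ) : ℂ := s.nu n * s.dP n x
def yd (n : ℕ) (x : ℝ) : ℂ := s.nu n * s.dy2 n x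
def r (n : ℕ) (x : ℝ) : ℂ :=
  s.dZ n x - Complex.I * s.lam n * (l * (1 + k₁ / k₃)) * s.S n x + l * s.y2 n x

lemma BdL2_congr {b : ℝ} {g h : ℕ → ℝ → ℂ} (hg : BdL2 b g) (e : ∀ n x, h n x = g n x) :
    BdL2 b h := by
  have : h = g := by ext n x; exact e n x
  rwa [this]

lemma SmL2_congr {b : ℝ} {g h : ℕ → ℝ → ℂ} (hg : SmL2 b g) (e : ∀ n x, h n x = g n x) :
    SmL2 b h := by
  have : h = g := by ext n x; exact e n x
  rwa [this]

lemma sm_r (h : Pos ρ₁ ρ₂ k₁ k₂ k₃ l L β a₀) : SmL2 β s.r := by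
  have hk3 : (k₃ : ℂ) ≠ 0 := by exact_mod_cast h.k3.ne'
  have F := s.facts h
  have hb := h.b
  refine SmL2_congr (((((s.smN hb F.y (Complex.I * Complex.I * ρ₁ / k₃) 0).add hb
    (s.smN hb F.y (Complex.I * a₀ / k₃) 1)).add hb (s.smN hb F.y (-l ^ 2) 2)).add hb
    (s.smN hb F.g6 (-(Complex.I * ρ₁ / k₃)) 3)).add hb (s.smN hb F.g1 (-l) 4)) ?_
  intro n x
  have hl := s.lam_ne n
  simp only [r, dZ, dN, dy1, Y, nu]
  field_simp
  ring

lemma bd_z (h : Pos ρ₁ ρ₂ k₁ k₂ k₃ l L β a₀) : BdL2 β s.z := by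
  have F := s.facts h
  refine BdL2_congr ((s.bdN h.b F.b6 Complex.I 0).add h.b (s.bdN h.b F.b1 l 1)) ?_
  intro n x
  have hl := s.lam_ne n
  simp only [z, Z, nu]
  field_simp

lemma bd_zd (h : Pos ρ₁ ρ₂ k₁ k₂ k₃ l L β a₀) : BdL2 β s.zd := by
  have F := s.facts h
  refine BdL2_congr (((s.bdN h.b F.b4 (Complex.I * (l * (1 + k₁ / k₃))) 0).add h.b
    (s.bdN h.b F.b2 (-l) 1)).add h.b (s.bdN h.b (s.sm_r h).bd 1 1)) ?_
  intro n x
  have hl := s.lam_ne n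
  simp only [zd, r, nu]
  field_simp
  ring

lemma bd_sd (h : Pos ρ₁ ρ₂ k₁ k₂ k₃ l L β a₀) : BdL2 β s.sd := by
  have hk1 : (k₁ : ℂ) ≠ 0 := by exact_mod_cast h.k1.ne'
  have F := s.facts h
  refine BdL2_congr (((s.bdN h.b F.b1 (Complex.I * ρ₁ / k₁) 0).add h.b
    (s.bdN h.b F.b6 (-l * k₃ / k₁) 1)).add h.b (s.bdN h.b F.g2.bd (-ρ₁ / k₁) 5)) ?_
  intro n x
  have hl := s.lam_ne n
  simp only [sd, dS, nu]
  field_simp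
  ring

lemma bd_pd (h : Pos ρ₁ ρ₂ k₁ k₂ k₃ l L β a₀) : BdL2 β s.pd := by
  have hk2 : (k₂ : ℂ) ≠ 0 := by exact_mod_cast h.k2.ne'
  have F := s.facts h
  refine BdL2_congr (((s.bdN h.b F.b2 (Complex.I * ρ₂ / k₂) 0).add h.b
    (s.bdN h.b F.b4 (k₁ / k₂) 1)).add h.b (s.bdN h.b F.g4.bd (-ρ₂ / k₂) 5)) ?_
  intro n x
  have hl := s.lam_ne n
  simp only [pd, dP, nu]
  field_simp
  ring

lemma bd_yd (h : Pos ρ₁ ρ₂ k₁ k₂ k₃ l L β a₀) : BdL2 β s.yd := by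
  have F := s.facts h
  refine BdL2_congr ((s.bdN h.b F.b5 Complex.I 0).add h.b (s.bdN h.b F.g3.bd (-1) 5)) ?_
  intro n x
  have hl := s.lam_ne n
  simp only [yd, dy2, nu]
  field_simp
  ring

end BSys


namespace BSys

variable {ρ₁ ρ₂ k₁ k₂ k₃ l L β a₀ : ℝ} (s : BSys ρ₁ ρ₂ k₁ k₂ k₃ l L β a₀)

lemma nQ {Q : ℕ → ℝ → ℂ} (hQ : NulI β Q) (c : ℂ) (m : ℕ) :
    NulI β (fun n x => c * s.nu n ^ m * Q n x) :=
  hQ.smul (fun n => c * s.nu n ^ m) ‖c‖ (fun n => by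
    rw [norm_mul, norm_pow]
    exact mul_le_of_le_one_right (norm_nonneg _) (pow_le_one₀ (norm_nonneg _) (s.nu_le n)))

def w0 (_ : ℝ) (_ : ℝ) : ℂ := 1
def w1 (β : ℝ) (x : ℝ) : ℂ := qf β x
def w2 (β : ℝ) (x : ℝ) : ℂ := qd β x
def w3 (β : ℝ) (x : ℝ) : ℂ := qf β x * qd β x
def w4 (β : ℝ) (x : ℝ) : ℂ := qf β x ^ 2
def w5 (β : ℝ) (x : ℝ) : ℂ := 2 * qd β x ^ 2 - 4 * qf β x

lemma cw0 (β : ℝ) : Continuous (w0 β) := continuous_const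
lemma cw1 (β : ℝ) : Continuous (w1 β) := cont_qf β
lemma cw2 (β : ℝ) : Continuous (w2 β) := cont_qd β
lemma cw3 (β : ℝ) : Continuous (w3 β) := (cont_qf β).mul (cont_qd β)
lemma cw4 (β : ℝ) : Continuous (w4 β) := (cont_qf β).pow 2
lemma cw5 (β : ℝ) : Continuous (w5 β) := by
  have h1 := cont_qf β
  have h2 := cont_qd β
  unfold w5
  fun_prop

/-- localized function -/
def loc (β : ℝ) (g : ℕ → ℝ → ℂ) (n : ℕ) (x : ℝ) : ℂ := qf β x * g n x

lemma cont_loc {g : ℕ → ℝ → ℂ} (hg : ∀ n, ContinuousOn (g n) (Icc 0 β)) (n : ℕ) :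
    ContinuousOn (loc β g n) (Icc 0 β) := (cont_qf β).continuousOn.mul (hg n)

lemma sm_Z (h : Pos ρ₁ ρ₂ k₁ k₂ k₃ l L β a₀) : SmL2 β (loc β s.Z) := by
  have F := s.facts h
  obtain ⟨d1, d2, d3, dS', dP', dZ'⟩ := s.ders h
  have hb := h.b
  refine SmL2.of_nul (cont_loc dZ'.1) ?_
  refine ((((dZ'.nul_eta hb d3).add hb
    (s.termS hb F.y.conj (s.bd_z h) (-2) 1 _ (cw3 β))).add hb
    (s.termS hb F.y.conj (s.bd_zd h) (-1) 1 _ (cw4 β))).add hb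
    (s.termS hb F.g5.conj (s.bd_z h) 1 3 _ (cw4 β))).congr ?_
  intro n x
  have hl := s.lam_ne n
  have e : (starRingEnd ℂ) (s.dy3 n x) = (starRingEnd ℂ) (s.Z n x)
      - (s.lam n : ℂ)⁻¹ ^ 4 * (starRingEnd ℂ) (s.G5 n x) := by
    simp only [dy3, Z, map_sub, map_mul, map_pow, map_inv₀, Complex.conj_ofReal]
  simp only [e, loc, w3, w4, z, zd, Y, nu, map_mul, map_pow, conj_qf, Complex.conj_ofReal]
  field_simp
  ring

lemma sm_S (h : Pos ρ₁ ρ₂ k₁ k₂ k₃ l L β a₀) : SmL2 β (loc β s.S) := by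
  have F := s.facts h
  obtain ⟨d1, d2, d3, dS', dP', dZ'⟩ := s.ders h
  have hb := h.b
  have hZ := s.sm_Z h
  have hc : Complex.I * (((l * (1 + k₁ / k₃)) : ℝ) : ℂ) ≠ 0 := by
    have h1 := h.pl
    have h2 := h.k1
    have h3 := h.k3
    have : l * (1 + k₁ / k₃) ≠ 0 := by positivity
    exact mul_ne_zero Complex.I_ne_zero (by exact_mod_cast this)
  refine SmL2.of_nul (cont_loc dS'.1) (NulI.of_cmul _ hc ?_)
  refine (((((s.nQ (dZ'.nul_eta hb dS') 1 1).add hb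
    (s.termS hb hZ F.b4.conj (-2) 1 _ (cw2 β))).add hb
    (s.termB hb F.b2 F.b4.conj l 0 _ (cw4 β))).add hb
    (s.termS hb (s.sm_r h) F.b4.conj (-1) 1 _ (cw4 β))).add hb
    (s.termS hb hZ (s.bd_sd h).conj (-1) 0 _ (cw1 β))).congr ?_
  intro n x
  have hl := s.lam_ne n
  simp only [Nat.reduceAdd, loc, w1, w2, w4, r, sd, nu, map_mul, map_inv₀, conj_qf, Complex.conj_ofReal,
    Complex.ofReal_mul, Complex.ofReal_add, Complex.ofReal_div, Complex.ofReal_one]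
  field_simp
  ring

lemma sm_y1 (h : Pos ρ₁ ρ₂ k₁ k₂ k₃ l L β a₀) : SmL2 β (loc β s.y1) := by
  have F := s.facts h
  obtain ⟨d1, d2, d3, dS', dP', dZ'⟩ := s.ders h
  have hb := h.b
  have hS := s.sm_S h
  have hk1 : (k₁ : ℂ) ≠ 0 := by exact_mod_cast h.k1.ne'
  have hr1 : (ρ₁ : ℂ) ≠ 0 := by exact_mod_cast h.r1.ne'
  refine SmL2.of_nul (cont_loc d1.1) (NulI.of_cmul _ (mul_ne_zero Complex.I_ne_zero hr1) ?_)
  refine ((((((((s.nQ (dS'.nul_eta hb d1) k₁ 1).add hb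
    (s.termB hb F.b4 F.b1.conj (-2 * k₁) 0 _ (cw3 β))).add hb
    (s.termB hb F.b6 F.b1.conj (l * k₃) 0 _ (cw4 β))).add hb
    (s.termS hb F.g2 F.b1.conj ρ₁ 5 _ (cw4 β))).add hb
    (s.termS hb hS hS.bd.conj (Complex.I * k₁) 0 _ (cw0 β))).add hb
    (s.termB hb F.b4 F.b2.conj k₁ 0 _ (cw4 β))).add hb
    (s.termB hb F.b4 F.b3.conj (k₁ * l) 0 _ (cw4 β))).add hb
    (s.termB hb F.b4 F.g1.bd.conj k₁ 4 _ (cw4 β))).congr ?_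
  intro n x
  have hl := s.lam_ne n
  simp only [Nat.reduceAdd, loc, w0, w3, w4, dS, dy1, nu, map_sub, map_mul, map_pow, map_inv₀, conj_qf,
    Complex.conj_I, Complex.conj_ofReal]
  field_simp
  ring

lemma sm_N (h : Pos ρ₁ ρ₂ k₁ k₂ k₃ l L β a₀) : SmL2 β (loc β s.N) := by
  have hb := h.b
  refine SmL2_congr ((s.smN hb (s.sm_Z h) Complex.I⁻¹ 1).add hb
    (s.smN hb (s.sm_y1 h) (-l * Complex.I⁻¹) 1)) ?_
  intro n x
  have hl := s.lam_ne n
  have hI := Complex.I_ne_zero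
  simp only [loc, Z, nu]
  generalize Complex.I = J at *
  field_simp
  ring

lemma nul_A (h : Pos ρ₁ ρ₂ k₁ k₂ k₃ l L β a₀) :
    NulI β (fun n x => (l * (1 + k₁ / k₃)) * Complex.I * s.lam n * qf β x ^ 2 *
      (s.S n x * (starRingEnd ℂ) (s.y2 n x)) -
      l * qf β x ^ 2 * (s.y2 n x * (starRingEnd ℂ) (s.y2 n x))) := by
  have F := s.facts h
  obtain ⟨d1, d2, d3, dS', dP', dZ'⟩ := s.ders h
  have hb := h.b
  refine (((((((((((dZ'.nul_eta hb d2).add hb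
    (s.nQ (d3.nul_eta' hb d2) (-1) 0)).add hb
    (s.nQ ((d3.smul (fun n => (s.lam n : ℂ))).nul_eta hb dP') Complex.I 0)).add hb
    (s.termS hb (s.sm_r h) F.b2.conj (-1) 0 _ (cw4 β))).add hb
    (s.termS hb F.g3.conj (s.bd_z h) 1 3 _ (cw4 β))).add hb
    (s.termS hb F.g5 F.b2.conj (-2) 4 _ (cw3 β))).add hb
    (s.termS hb F.g5 F.b5.conj Complex.I 3 _ (cw4 β))).add hb
    (s.termS hb F.y F.b2.conj 1 2 _ (cw5 β))).add hb
    (s.termS hb F.y (s.bd_yd h).conj 2 1 _ (cw3 β))).add hb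
    (s.termS hb F.y F.b5.conj (-2 * Complex.I) 1 _ (cw3 β))).add hb
    (s.termS hb F.y (s.bd_pd h).conj (-Complex.I) 0 _ (cw4 β))).congr ?_
  intro n x
  have hl := s.lam_ne n
  have e : s.dy3 n x = s.Z n x - (s.lam n : ℂ)⁻¹ ^ 4 * s.G5 n x := rfl
  have e2 : (starRingEnd ℂ) (s.dy2 n x) = -Complex.I * s.lam n * (starRingEnd ℂ) (s.P n x)
      - (s.lam n : ℂ)⁻¹ ^ 4 * (starRingEnd ℂ) (s.G3 n x) := by
    simp only [dy2, map_sub, map_mul, map_pow, map_inv₀, Complex.conj_ofReal, Complex.conj_I]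
  have e3 : s.dZ n x = s.r n x + Complex.I * s.lam n * (l * (1 + k₁ / k₃)) * s.S n x
      - l * s.y2 n x := by
    unfold r; ring
  simp only [w3, w4, w5, z, pd, yd, Y, nu, map_mul, map_pow, map_inv₀, Complex.conj_ofReal,
    e, e2, e3]
  field_simp
  ring

lemma nul_B (h : Pos ρ₁ ρ₂ k₁ k₂ k₃ l L β a₀) :
    NulI β (fun n x => Complex.I * s.lam n * (ρ₁ - k₁ * ρ₂ / k₂) * qf β x ^ 2 *
      (s.S n x * (starRingEnd ℂ) (s.y2 n x)) -
      ρ₁ * qf β x ^ 2 * (s.y2 n x * (starRingEnd ℂ) (s.y2 n x))) := by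
  have F := s.facts h
  obtain ⟨d1, d2, d3, dS', dP', dZ'⟩ := s.ders h
  have hb := h.b
  have hS := s.sm_S h
  have hy := s.sm_y1 h
  have hk1 : (k₁ : ℂ) ≠ 0 := by exact_mod_cast h.k1.ne'
  have hk2 : (k₂ : ℂ) ≠ 0 := by exact_mod_cast h.k2.ne'
  refine (((((((((((s.nQ (dS'.nul_eta hb dP') k₁ 0).add hb
    (s.nQ (d1.nul_eta hb d2) ρ₁ 0)).add hb
    (s.termS hb hS F.b5.conj (-2 * k₁) 0 _ (cw2 β))).add hb
    (s.termS hb hy F.b2.conj (-2 * ρ₁) 0 _ (cw2 β))).add hb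
    (s.termS hb (s.sm_N h) F.b5.conj (l * k₃) 0 _ (cw1 β))).add hb
    (s.termS hb F.g2 F.b5.conj ρ₁ 4 _ (cw4 β))).add hb
    (s.termS hb hS hS.bd.conj (-(k₁ ^ 2 / k₂)) 0 _ (cw0 β))).add hb
    (s.termB hb F.b4 F.g4.bd.conj (k₁ * ρ₂ / k₂) 3 _ (cw4 β))).add hb
    (s.termS hb F.y F.b2.conj (ρ₁ * l) 2 _ (cw4 β))).add hb
    (s.termS hb F.g1 F.b2.conj ρ₁ 4 _ (cw4 β))).add hb
    (s.termB hb F.b1 F.g3.bd.conj ρ₁ 3 _ (cw4 β))).congr ?_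
  intro n x
  have hl := s.lam_ne n
  simp only [Nat.reduceAdd, loc, w0, w1, w2, w4, dS, dP, dy1, dy2, Y, nu, map_sub, map_add, map_mul, map_div₀,
    map_pow, map_inv₀, conj_qf, Complex.conj_I, Complex.conj_ofReal]
  field_simp
  ring

lemma sm_y2 (h : Pos ρ₁ ρ₂ k₁ k₂ k₃ l L β a₀) : SmL2 β (loc β s.y2) := by
  have hb := h.b
  obtain ⟨d1, d2, d3, dS', dP', dZ'⟩ := s.ders h
  have hc : ((l * (ρ₁ * k₁ / k₃ + k₁ * ρ₂ / k₂) : ℝ) : ℂ) ≠ 0 := by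
    have h0 := h.pl
    have h1 := h.r1
    have h2 := h.r2
    have h3 := h.k1
    have h4 := h.k2
    have h5 := h.k3
    have : l * (ρ₁ * k₁ / k₃ + k₁ * ρ₂ / k₂) ≠ 0 := by positivity
    exact_mod_cast this
  refine SmL2.of_nul (cont_loc d2.1) (NulI.of_cmul _ hc ?_)
  refine (((s.nul_A h).cmul (ρ₁ - k₁ * ρ₂ / k₂)).add hb
    ((s.nul_B h).cmul (-(l * (1 + k₁ / k₃))))).congr ?_
  intro n x
  simp only [loc, map_mul, conj_qf, Complex.ofReal_mul, Complex.ofReal_add, Complex.ofReal_div]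
  ring

lemma sm_P (h : Pos ρ₁ ρ₂ k₁ k₂ k₃ l L β a₀) : SmL2 β (loc β s.P) := by
  have F := s.facts h
  obtain ⟨d1, d2, d3, dS', dP', dZ'⟩ := s.ders h
  have hb := h.b
  have hy := s.sm_y2 h
  have hk2 : (k₂ : ℂ) ≠ 0 := by exact_mod_cast h.k2.ne'
  refine SmL2.of_nul (cont_loc dP'.1) (NulI.of_cmul _ (mul_ne_zero Complex.I_ne_zero hk2) ?_)
  refine ((((((s.nQ (dP'.nul_eta hb d2) (-k₂) 1).add hb
    (s.termB hb F.b5 F.b2.conj (2 * k₂) 0 _ (cw3 β))).add hb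
    (s.termS hb hy hy.bd.conj (Complex.I * ρ₂) 0 _ (cw0 β))).add hb
    (s.termB hb F.b4 F.b2.conj k₁ 0 _ (cw4 β))).add hb
    (s.termS hb F.g4 F.b2.conj (-ρ₂) 5 _ (cw4 β))).add hb
    (s.termB hb F.b5 F.g3.bd.conj (-k₂) 4 _ (cw4 β))).congr ?_
  intro n x
  have hl := s.lam_ne n
  simp only [Nat.reduceAdd, loc, w0, w3, w4, dP, dy2, nu, map_sub, map_mul, map_pow, map_inv₀, conj_qf,
    Complex.conj_I, Complex.conj_ofReal]
  field_simp
  ring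

lemma sm_y3 (h : Pos ρ₁ ρ₂ k₁ k₂ k₃ l L β a₀) : SmL2 β (loc β s.y3) := by
  have F := s.facts h
  refine SmL2_congr ((s.smN h.b F.y 1 2).weight h.b (qf β) (cont_qf β)) ?_
  intro n x
  have hl := s.lam_ne n
  simp only [loc, Y, nu]
  field_simp

lemma loc_dens (h : Pos ρ₁ ρ₂ k₁ k₂ k₃ l L β a₀) :
    Tendsto (fun n => ∫ x in (0 : ℝ)..β, ‖qf β x‖ ^ 2 * s.dens n x) atTop (nhds 0) := by
  have hb := h.b
  have h1 := s.sm_S h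
  have h2 := s.sm_y1 h
  have h3 := s.sm_P h
  have h4 := s.sm_y2 h
  have h5 := s.sm_N h
  have h6 := s.sm_y3 h
  have T := (((((h1.2.const_mul k₁).add (h2.2.const_mul ρ₁)).add (h3.2.const_mul k₂)).add
    (h4.2.const_mul ρ₂)).add (h5.2.const_mul k₃)).add (h6.2.const_mul ρ₁)
  simp only [mul_zero, add_zero] at T
  refine T.congr fun n => ?_
  have i : ∀ {g : ℕ → ℝ → ℂ} (c : ℝ), SmL2 β (loc β g) →
      IntervalIntegrable (fun x => c * ‖loc β g n x‖ ^ 2) volume 0 β := fun c hg =>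
    (ii_of_cont hb ((hg.1 n).norm.pow 2)).const_mul c
  simp only [← intervalIntegral.integral_const_mul]
  rw [← intervalIntegral.integral_add (i _ h1) (i _ h2),
    ← intervalIntegral.integral_add ((i _ h1).add (i _ h2)) (i _ h3),
    ← intervalIntegral.integral_add (((i _ h1).add (i _ h2)).add (i _ h3)) (i _ h4),
    ← intervalIntegral.integral_add ((((i _ h1).add (i _ h2)).add (i _ h3)).add (i _ h4)) (i _ h5),
    ← intervalIntegral.integral_add
      (((((i _ h1).add (i _ h2)).add (i _ h3)).add (i _ h4)).add (i _ h5)) (i _ h6)]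
  apply intervalIntegral.integral_congr
  intro x _
  simp only [loc, dens, norm_mul]
  ring

end BSys

lemma hd_nsq {f : ℝ → ℂ} {f' : ℂ} {x : ℝ} (h : HasDerivAt f f' x) :
    HasDerivAt (fun t => ‖f t‖ ^ 2) (2 * (f' * (starRingEnd ℂ) (f x)).re) x := by
  have h1 : HasDerivAt (fun t => f t * (starRingEnd ℂ) (f t)) _ x := h.mul (hd_conj h)
  have hre := Complex.reCLM.hasFDerivAt.comp_hasDerivAt x h1
  have e : (fun t => ‖f t‖ ^ 2) = (Complex.reCLM ∘ fun t => f t * (starRingEnd ℂ) (f t)) := by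
    ext t
    simp [Complex.mul_conj, Complex.normSq_eq_norm_sq, -Complex.ofReal_pow,
      ← Complex.ofReal_pow]
  rw [e]
  refine hre.congr_deriv ?_
  simp
  ring

lemma prod_bd {α K u v T : ℝ} (hα : 0 ≤ α) (hK : α ≤ K) (h : u ^ 2 + v ^ 2 ≤ T) :
    2 * (α * u * v) ≤ K * T := by
  have h1 : 2 * u * v ≤ T := (two_mul_le_add_sq u v).trans h
  have h2 : 0 ≤ T := le_trans (by positivity) h
  calc 2 * (α * u * v) = α * (2 * u * v) := by ring
    _ ≤ α * T := by gcongr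
    _ ≤ K * T := by gcongr

namespace BSys

variable {ρ₁ ρ₂ k₁ k₂ k₃ l L β a₀ : ℝ} (s : BSys ρ₁ ρ₂ k₁ k₂ k₃ l L β a₀)

/-- lower order part of the derivative of the energy density -/
def W0 (n : ℕ) (x : ℝ) (a : ℝ) : ℂ :=
  ρ₁ * ((-s.y2 n x - l * s.y3 n x - (s.lam n : ℂ)⁻¹ ^ 4 * s.G1 n x) *
    (starRingEnd ℂ) (s.y1 n x))
  + (-l * k₃ * s.N n x - ρ₁ * (s.lam n : ℂ)⁻¹ ^ 4 * s.G2 n x) * (starRingEnd ℂ) (s.S n x)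
  + ρ₂ * ((-(s.lam n : ℂ)⁻¹ ^ 4 * s.G3 n x) * (starRingEnd ℂ) (s.y2 n x))
  + (k₁ * s.S n x - ρ₂ * (s.lam n : ℂ)⁻¹ ^ 4 * s.G4 n x) * (starRingEnd ℂ) (s.P n x)
  + ρ₁ * ((l * s.y1 n x - (s.lam n : ℂ)⁻¹ ^ 4 * s.G5 n x) * (starRingEnd ℂ) (s.y3 n x))
  + (l * k₁ * s.S n x + a * s.y3 n x - ρ₁ * (s.lam n : ℂ)⁻¹ ^ 4 * s.G6 n x) *
    (starRingEnd ℂ) (s.N n x)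

lemma d_dens (h : Pos ρ₁ ρ₂ k₁ k₂ k₃ l L β a₀) (n : ℕ) (x : ℝ)
    (hx : x ∈ Ioo (0 : ℝ) β ∪ Ioo β L) :
    HasDerivAt (s.dens n) (2 * (s.W0 n x (if x < β then a₀ else 0)).re) x := by
  have h1 := s.d_y1 n x hx
  have h2 := s.d_y2 n x hx
  have h3 := s.d_y3 n x hx
  have h4 := s.d_S n x hx
  have h5 := s.d_P n x hx
  have h6 := s.d_N n x hx
  have hk1 : (k₁ : ℂ) ≠ 0 := by exact_mod_cast h.k1.ne'
  have hk2 : (k₂ : ℂ) ≠ 0 := by exact_mod_cast h.k2.ne'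
  have hk3 : (k₃ : ℂ) ≠ 0 := by exact_mod_cast h.k3.ne'
  have hQ : HasDerivAt (s.dens n) _ x :=
    ((((((hd_nsq h4).const_mul k₁).add ((hd_nsq h1).const_mul ρ₁)).add
      ((hd_nsq h5).const_mul k₂)).add ((hd_nsq h2).const_mul ρ₂)).add
      ((hd_nsq h6).const_mul k₃)).add ((hd_nsq h3).const_mul ρ₁)
  refine hQ.congr_deriv ?_
  generalize ha : (if x < β then (a₀ : ℂ) else 0) = a
  have ha' : ((if x < β then a₀ else 0 : ℝ) : ℂ) = a := by
    rw [← ha]; split_ifs <;> simp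
  generalize (if x < β then a₀ else 0 : ℝ) = a' at ha'
  subst ha'
  set X : ℂ := ρ₁ * (s.S n x * (starRingEnd ℂ) (s.y1 n x))
    + ρ₂ * (s.P n x * (starRingEnd ℂ) (s.y2 n x))
    + ρ₁ * (s.N n x * (starRingEnd ℂ) (s.y3 n x)) with hX
  have hXi : (Complex.I * s.lam n * (X + (starRingEnd ℂ) X)).re = 0 := by
    rw [Complex.add_conj]
    simp
  have key : ∀ c : ℝ, ∀ w : ℂ, c * (2 * w.re) = 2 * ((c : ℂ) * w).re := by
    intro c w
    rw [Complex.re_ofReal_mul]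
    ring
  simp only [key]
  rw [← mul_add, ← mul_add, ← mul_add, ← mul_add, ← mul_add]
  congr 1
  simp only [← Complex.add_re]
  rw [← add_zero (s.W0 n x a').re, ← hXi, ← Complex.add_re]
  congr 1
  simp only [hX, W0, map_add, map_mul, Complex.conj_conj, Complex.conj_ofReal]
  generalize (s.lam n : ℂ)⁻¹ = v
  field_simp
  ring

lemma densF_nonneg (h : Pos ρ₁ ρ₂ k₁ k₂ k₃ l L β a₀) (n : ℕ) (x : ℝ) : 0 ≤ s.densF n x := by
  obtain ⟨h1, h2, h3, h4, h5, h6, h7, h8, h9, h10⟩ := h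
  unfold densF
  positivity

lemma dens_nonneg (h : Pos ρ₁ ρ₂ k₁ k₂ k₃ l L β a₀) (n : ℕ) (x : ℝ) : 0 ≤ s.dens n x := by
  obtain ⟨h1, h2, h3, h4, h5, h6, h7, h8, h9, h10⟩ := h
  unfold dens
  positivity

lemma six_bd (h : Pos ρ₁ ρ₂ k₁ k₂ k₃ l L β a₀) :
    ∃ κ : ℝ, 0 ≤ κ ∧ ∀ u1 u2 u3 u4 u5 u6 : ℝ,
      u1 ^ 2 + u2 ^ 2 + u3 ^ 2 + u4 ^ 2 + u5 ^ 2 + u6 ^ 2 ≤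
      κ * (k₁ * u1 ^ 2 + ρ₁ * u2 ^ 2 + k₂ * u3 ^ 2 + ρ₂ * u4 ^ 2 + k₃ * u5 ^ 2 + ρ₁ * u6 ^ 2) := by
  obtain ⟨h1, h2, h3, h4, h5, h6, h7, h8, h9, h10⟩ := h
  refine ⟨k₁⁻¹ + k₂⁻¹ + k₃⁻¹ + ρ₁⁻¹ + ρ₂⁻¹, by positivity, fun u1 u2 u3 u4 u5 u6 => ?_⟩
  have key : ∀ c κ u : ℝ, 0 < c → c⁻¹ ≤ κ → u ^ 2 ≤ κ * (c * u ^ 2) := by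
    intro c κ u hc hk
    calc u ^ 2 = c⁻¹ * (c * u ^ 2) := by field_simp
      _ ≤ κ * (c * u ^ 2) := by gcongr
  have i1 : 0 < k₁⁻¹ := by positivity
  have i2 : 0 < k₂⁻¹ := by positivity
  have i3 : 0 < k₃⁻¹ := by positivity
  have i4 : 0 < ρ₁⁻¹ := by positivity
  have i5 : 0 < ρ₂⁻¹ := by positivity
  set κ := k₁⁻¹ + k₂⁻¹ + k₃⁻¹ + ρ₁⁻¹ + ρ₂⁻¹ with hκ
  have e1 := key k₁ κ u1 h3 (by linarith)
  have e2 := key ρ₁ κ u2 h1 (by linarith)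
  have e3 := key k₂ κ u3 h4 (by linarith)
  have e4 := key ρ₂ κ u4 h2 (by linarith)
  have e5 := key k₃ κ u5 h5 (by linarith)
  have e6 := key ρ₁ κ u6 h1 (by linarith)
  simp only [mul_add]
  linarith

lemma W0_bd (h : Pos ρ₁ ρ₂ k₁ k₂ k₃ l L β a₀) :
    ∃ C : ℝ, 0 ≤ C ∧ ∀ n x, ∀ a : ℝ, 0 ≤ a → a ≤ a₀ →
      |2 * (s.W0 n x a).re| ≤ C * s.dens n x + C * s.densF n x := by
  obtain ⟨κ, hκ, hk⟩ := six_bd h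
  obtain ⟨h1, h2, h3, h4, h5, h6, h7, h8, h9, h10⟩ := h
  set K : ℝ := ρ₁ + ρ₂ + k₁ + ρ₁ * l + l * k₃ + l * k₁ + a₀ with hK
  have p1 : 0 < ρ₁ * l := by positivity
  have p2 : 0 < l * k₃ := by positivity
  have p3 : 0 < l * k₁ := by positivity
  have hK0 : 0 < K := by linarith
  refine ⟨14 * K * κ, by positivity, fun n x a ha0 ha => ?_⟩
  have b1 := hk ‖s.S n x‖ ‖s.y1 n x‖ ‖s.P n x‖ ‖s.y2 n x‖ ‖s.N n x‖ ‖s.y3 n x‖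
  have b2 := hk ‖s.G1 n x‖ ‖s.G2 n x‖ ‖s.G3 n x‖ ‖s.G4 n x‖ ‖s.G5 n x‖ ‖s.G6 n x‖
  have hv : ‖(s.lam n : ℂ)⁻¹ ^ 4‖ ≤ 1 := by
    rw [norm_pow]
    exact pow_le_one₀ (norm_nonneg _) (s.nu_le n)
  have b1' : _ ≤ κ * s.dens n x := b1
  have b2' : _ ≤ κ * s.densF n x := b2
  set T := κ * s.dens n x + κ * s.densF n x with hT
  have tri : ‖s.W0 n x a‖ ≤
      (ρ₁ * ‖s.y2 n x‖ * ‖s.y1 n x‖ + ρ₁ * l * ‖s.y3 n x‖ * ‖s.y1 n x‖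
        + ρ₁ * ‖s.G1 n x‖ * ‖s.y1 n x‖)
      + (l * k₃ * ‖s.N n x‖ * ‖s.S n x‖ + ρ₁ * ‖s.G2 n x‖ * ‖s.S n x‖)
      + (ρ₂ * ‖s.G3 n x‖ * ‖s.y2 n x‖)
      + (k₁ * ‖s.S n x‖ * ‖s.P n x‖ + ρ₂ * ‖s.G4 n x‖ * ‖s.P n x‖)
      + (ρ₁ * l * ‖s.y1 n x‖ * ‖s.y3 n x‖ + ρ₁ * ‖s.G5 n x‖ * ‖s.y3 n x‖)
      + (l * k₁ * ‖s.S n x‖ * ‖s.N n x‖ + a * ‖s.y3 n x‖ * ‖s.N n x‖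
        + ρ₁ * ‖s.G6 n x‖ * ‖s.N n x‖) := by
    have hn : ∀ c : ℝ, 0 ≤ c → ‖(c : ℂ)‖ = c := fun c hc => by
      rw [Complex.norm_real, Real.norm_eq_abs, abs_of_nonneg hc]
    have hvG : ∀ c : ℝ, 0 ≤ c → ∀ G : ℂ, ‖(c : ℂ) * (s.lam n : ℂ)⁻¹ ^ 4 * G‖ ≤ c * ‖G‖ := by
      intro c hc G
      rw [norm_mul, norm_mul, hn c hc]
      have : c * ‖(s.lam n : ℂ)⁻¹ ^ 4‖ ≤ c := mul_le_of_le_one_right hc hv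
      gcongr
    have hvG1 : ∀ G : ℂ, ‖(s.lam n : ℂ)⁻¹ ^ 4 * G‖ ≤ ‖G‖ := by
      intro G
      rw [norm_mul]
      exact mul_le_of_le_one_left (norm_nonneg _) hv
    unfold W0
    refine (norm_add_le _ _).trans (add_le_add ((norm_add_le _ _).trans (add_le_add
      ((norm_add_le _ _).trans (add_le_add ((norm_add_le _ _).trans (add_le_add
      ((norm_add_le _ _).trans (add_le_add ?_ ?_)) ?_)) ?_)) ?_)) ?_)
    · rw [norm_mul, norm_mul, hn _ h1.le, Complex.norm_conj]
      have : ‖-s.y2 n x - l * s.y3 n x - (s.lam n : ℂ)⁻¹ ^ 4 * s.G1 n x‖ ≤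
          ‖s.y2 n x‖ + l * ‖s.y3 n x‖ + ‖s.G1 n x‖ := by
        refine (norm_sub_le _ _).trans (add_le_add ((norm_sub_le _ _).trans (add_le_add ?_ ?_)) ?_)
        · rw [norm_neg]
        · rw [norm_mul, hn _ h6.le]
        · exact hvG1 _
      calc _ ≤ ρ₁ * ((‖s.y2 n x‖ + l * ‖s.y3 n x‖ + ‖s.G1 n x‖) * ‖s.y1 n x‖) := by gcongr
        _ = _ := by ring
    · rw [norm_mul, Complex.norm_conj]
      have : ‖-l * k₃ * s.N n x - ρ₁ * (s.lam n : ℂ)⁻¹ ^ 4 * s.G2 n x‖ ≤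
          l * k₃ * ‖s.N n x‖ + ρ₁ * ‖s.G2 n x‖ := by
        refine (norm_sub_le _ _).trans (add_le_add ?_ (hvG _ h1.le _))
        rw [norm_mul, norm_mul, norm_neg, hn _ h6.le, hn _ h5.le]
      calc _ ≤ (l * k₃ * ‖s.N n x‖ + ρ₁ * ‖s.G2 n x‖) * ‖s.S n x‖ := by gcongr
        _ = _ := by ring
    · rw [norm_mul, norm_mul, hn _ h2.le, Complex.norm_conj, neg_mul, norm_neg]
      have := hvG1 (s.G3 n x)
      rw [mul_assoc]
      gcongr
    · rw [norm_mul, Complex.norm_conj]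
      have : ‖k₁ * s.S n x - ρ₂ * (s.lam n : ℂ)⁻¹ ^ 4 * s.G4 n x‖ ≤
          k₁ * ‖s.S n x‖ + ρ₂ * ‖s.G4 n x‖ := by
        refine (norm_sub_le _ _).trans (add_le_add ?_ (hvG _ h2.le _))
        rw [norm_mul, hn _ h3.le]
      calc _ ≤ (k₁ * ‖s.S n x‖ + ρ₂ * ‖s.G4 n x‖) * ‖s.P n x‖ := by gcongr
        _ = _ := by ring
    · rw [norm_mul, norm_mul, hn _ h1.le, Complex.norm_conj]
      have : ‖l * s.y1 n x - (s.lam n : ℂ)⁻¹ ^ 4 * s.G5 n x‖ ≤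
          l * ‖s.y1 n x‖ + ‖s.G5 n x‖ := by
        refine (norm_sub_le _ _).trans (add_le_add ?_ (hvG1 _))
        rw [norm_mul, hn _ h6.le]
      calc _ ≤ ρ₁ * ((l * ‖s.y1 n x‖ + ‖s.G5 n x‖) * ‖s.y3 n x‖) := by gcongr
        _ = _ := by ring
    · rw [norm_mul, Complex.norm_conj]
      have : ‖l * k₁ * s.S n x + a * s.y3 n x - ρ₁ * (s.lam n : ℂ)⁻¹ ^ 4 * s.G6 n x‖ ≤
          l * k₁ * ‖s.S n x‖ + a * ‖s.y3 n x‖ + ρ₁ * ‖s.G6 n x‖ := by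
        refine (norm_sub_le _ _).trans (add_le_add ((norm_add_le _ _).trans
          (add_le_add ?_ ?_)) (hvG _ h1.le _))
        · rw [norm_mul, norm_mul, hn _ h6.le, hn _ h3.le]
        · rw [norm_mul, hn _ ha0]
      calc _ ≤ (l * k₁ * ‖s.S n x‖ + a * ‖s.y3 n x‖ + ρ₁ * ‖s.G6 n x‖) * ‖s.N n x‖ := by gcongr
        _ = _ := by ring
  have q1 := sq_nonneg ‖s.S n x‖
  have q2 := sq_nonneg ‖s.y1 n x‖
  have q3 := sq_nonneg ‖s.P n x‖
  have q4 := sq_nonneg ‖s.y2 n x‖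
  have q5 := sq_nonneg ‖s.N n x‖
  have q6 := sq_nonneg ‖s.y3 n x‖
  have r1 := sq_nonneg ‖s.G1 n x‖
  have r2 := sq_nonneg ‖s.G2 n x‖
  have r3 := sq_nonneg ‖s.G3 n x‖
  have r4 := sq_nonneg ‖s.G4 n x‖
  have r5 := sq_nonneg ‖s.G5 n x‖
  have r6 := sq_nonneg ‖s.G6 n x‖
  have hT0 : 0 ≤ K * T := by
    have : 0 ≤ T := by linarith
    positivity
  have t1 := prod_bd (α := ρ₁) (K := K) (u := ‖s.y2 n x‖) (v := ‖s.y1 n x‖) (T := T) h1.le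
    (by linarith) (by linarith)
  have t2 := prod_bd (α := ρ₁ * l) (K := K) (u := ‖s.y3 n x‖) (v := ‖s.y1 n x‖) (T := T) p1.le
    (by linarith) (by linarith)
  have t3 := prod_bd (α := ρ₁) (K := K) (u := ‖s.G1 n x‖) (v := ‖s.y1 n x‖) (T := T) h1.le
    (by linarith) (by linarith)
  have t4 := prod_bd (α := l * k₃) (K := K) (u := ‖s.N n x‖) (v := ‖s.S n x‖) (T := T) p2.le
    (by linarith) (by linarith)
  have t5 := prod_bd (α := ρ₁) (K := K) (u := ‖s.G2 n x‖) (v := ‖s.S n x‖) (T := T) h1.le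
    (by linarith) (by linarith)
  have t6 := prod_bd (α := ρ₂) (K := K) (u := ‖s.G3 n x‖) (v := ‖s.y2 n x‖) (T := T) h2.le
    (by linarith) (by linarith)
  have t7 := prod_bd (α := k₁) (K := K) (u := ‖s.S n x‖) (v := ‖s.P n x‖) (T := T) h3.le
    (by linarith) (by linarith)
  have t8 := prod_bd (α := ρ₂) (K := K) (u := ‖s.G4 n x‖) (v := ‖s.P n x‖) (T := T) h2.le
    (by linarith) (by linarith)
  have t9 := prod_bd (α := ρ₁ * l) (K := K) (u := ‖s.y1 n x‖) (v := ‖s.y3 n x‖) (T := T) p1.le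
    (by linarith) (by linarith)
  have t10 := prod_bd (α := ρ₁) (K := K) (u := ‖s.G5 n x‖) (v := ‖s.y3 n x‖) (T := T) h1.le
    (by linarith) (by linarith)
  have t11 := prod_bd (α := l * k₁) (K := K) (u := ‖s.S n x‖) (v := ‖s.N n x‖) (T := T) p3.le
    (by linarith) (by linarith)
  have t12 := prod_bd (α := a) (K := K) (u := ‖s.y3 n x‖) (v := ‖s.N n x‖) (T := T) ha0
    (by linarith) (by linarith)
  have t13 := prod_bd (α := ρ₁) (K := K) (u := ‖s.G6 n x‖) (v := ‖s.N n x‖) (T := T) h1.le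
    (by linarith) (by linarith)
  have e1 : |2 * (s.W0 n x a).re| ≤ 2 * ‖s.W0 n x a‖ := by
    rw [abs_mul, abs_two]
    have := Complex.abs_re_le_norm (s.W0 n x a)
    linarith
  have e2 : 14 * K * κ * s.dens n x + 14 * K * κ * s.densF n x = 14 * (K * T) := by
    rw [hT]; ring
  rw [e2]
  linarith

lemma harnack (h : Pos ρ₁ ρ₂ k₁ k₂ k₃ l L β a₀) :
    ∃ K : ℝ, 0 < K ∧ ∀ n, ∀ x ∈ Icc 0 L, ∀ y ∈ Icc 0 L,
      s.dens n y ≤ K * (s.dens n x + ∫ t in (0 : ℝ)..L, s.densF n t) := by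
  obtain ⟨C, hC, hW⟩ := s.W0_bd h
  have hb := h.b
  have hbL := h.bL
  have ha := h.a
  set K1 := Real.exp (C * (β - 0)) with hK1
  set K2 := Real.exp (C * (L - β)) with hK2
  have k1 : 1 ≤ K1 := Real.one_le_exp (mul_nonneg hC (by linarith))
  have k2 : 1 ≤ K2 := Real.one_le_exp (mul_nonneg hC (by linarith))
  refine ⟨K1 * K2 * (1 + 2 * C), by positivity, fun n x hx y hy => ?_⟩
  set I := ∫ t in (0 : ℝ)..L, s.densF n t with hI
  have hcF := s.cont_densF n
  have hcE := s.cont_dens n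
  have s1 : Icc 0 β ⊆ Icc 0 L := Icc_subset_Icc_right hbL.le
  have s2 : Icc β L ⊆ Icc 0 L := Icc_subset_Icc_left hb.le
  have I1 : IntervalIntegrable (s.densF n) volume 0 β := ii_of_cont hb (hcF.mono s1)
  have I2 : IntervalIntegrable (s.densF n) volume β L :=
    ContinuousOn.intervalIntegrable (by rw [uIcc_of_le hbL.le]; exact hcF.mono s2)
  have hadd := intervalIntegral.integral_add_adjacent_intervals I1 I2
  have n1 : 0 ≤ ∫ t in (0 : ℝ)..β, s.densF n t :=
    intervalIntegral.integral_nonneg hb.le (fun t _ => s.densF_nonneg h n t)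
  have n2 : 0 ≤ ∫ t in β..L, s.densF n t :=
    intervalIntegral.integral_nonneg hbL.le (fun t _ => s.densF_nonneg h n t)
  have g1 : ∀ x ∈ Icc 0 β, ∀ y ∈ Icc 0 β, s.dens n y ≤ K1 * (s.dens n x + C * I) := by
    intro x hx y hy
    have := gronwall_piece hb hC (hcE.mono s1) (D := fun t => C * s.densF n t)
      (continuousOn_const.mul (hcF.mono s1)) (fun t ht => s.d_dens h n t (Or.inl ht))
      (fun t _ => mul_nonneg hC (s.densF_nonneg h n t)) (fun t _ => s.dens_nonneg h n t)
      (fun t ht => hW n t _ (by split_ifs <;> linarith) (by split_ifs <;> linarith)) x y hx hy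
    rw [intervalIntegral.integral_const_mul] at this
    refine this.trans ?_
    have : (∫ t in (0 : ℝ)..β, s.densF n t) ≤ I := by linarith
    gcongr
  have g2 : ∀ x ∈ Icc β L, ∀ y ∈ Icc β L, s.dens n y ≤ K2 * (s.dens n x + C * I) := by
    intro x hx y hy
    have := gronwall_piece hbL hC (hcE.mono s2) (D := fun t => C * s.densF n t)
      (continuousOn_const.mul (hcF.mono s2)) (fun t ht => s.d_dens h n t (Or.inr ht))
      (fun t _ => mul_nonneg hC (s.densF_nonneg h n t)) (fun t _ => s.dens_nonneg h n t)
      (fun t ht => hW n t _ (by split_ifs <;> linarith) (by split_ifs <;> linarith)) x y hx hy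
    rw [intervalIntegral.integral_const_mul] at this
    refine this.trans ?_
    have : (∫ t in β..L, s.densF n t) ≤ I := by linarith
    gcongr
  have hI0 : 0 ≤ I := by linarith
  have hCI : 0 ≤ C * I := by positivity
  have hEx := s.dens_nonneg h n x
  have hEy := s.dens_nonneg h n y
  have hEb := s.dens_nonneg h n β
  have hfin : s.dens n y ≤ K1 * K2 * (s.dens n x + 2 * (C * I)) := by
    have mb1 : β ∈ Icc 0 β := ⟨hb.le, le_rfl⟩
    have mb2 : β ∈ Icc β L := ⟨le_rfl, hbL.le⟩
    have hA : K1 ≤ K1 * K2 := le_mul_of_one_le_right (by positivity) k2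
    have hB : K2 ≤ K1 * K2 := le_mul_of_one_le_left (by positivity) k1
    rcases le_total x β with hxb | hxb <;> rcases le_total y β with hyb | hyb
    · refine (g1 x ⟨hx.1, hxb⟩ y ⟨hy.1, hyb⟩).trans ?_
      exact mul_le_mul hA (by linarith) (by positivity) (by positivity)
    · have e1 := g1 x ⟨hx.1, hxb⟩ β mb1
      have e2 := g2 β mb2 y ⟨hyb, hy.2⟩
      calc _ ≤ _ := e2
        _ ≤ K2 * (K1 * (s.dens n x + C * I) + K1 * (C * I)) := by
          have : C * I ≤ K1 * (C * I) := le_mul_of_one_le_left hCI k1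
          gcongr
        _ = _ := by ring
    · have e1 := g2 x ⟨hxb, hx.2⟩ β mb2
      have e2 := g1 β mb1 y ⟨hy.1, hyb⟩
      calc _ ≤ _ := e2
        _ ≤ K1 * (K2 * (s.dens n x + C * I) + K2 * (C * I)) := by
          have : C * I ≤ K2 * (C * I) := le_mul_of_one_le_left hCI k2
          gcongr
        _ = _ := by ring
    · refine (g2 x ⟨hxb, hx.2⟩ y ⟨hyb, hy.2⟩).trans ?_
      exact mul_le_mul hB (by linarith) (by positivity) (by positivity)
  refine hfin.trans ?_
  rw [mul_assoc (K1 * K2)]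
  have : s.dens n x + 2 * (C * I) ≤ (1 + 2 * C) * (s.dens n x + I) := by
    have : 0 ≤ 2 * C * s.dens n x := by positivity
    nlinarith
  gcongr

theorem contra (s : BSys ρ₁ ρ₂ k₁ k₂ k₃ l L β a₀)
    (h : Pos ρ₁ ρ₂ k₁ k₂ k₃ l L β a₀) : False := by
  obtain ⟨K, hK, hH⟩ := s.harnack h
  have hb := h.b
  have hbL := h.bL
  have hL := h.pL
  set I : ℕ → ℝ := fun n => ∫ t in (0 : ℝ)..L, s.densF n t with hI
  have hI0 : Tendsto I atTop (nhds 0) := s.normF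
  have low : ∀ n, ∀ x ∈ Icc 0 L, (L * K)⁻¹ - I n ≤ s.dens n x := by
    intro n x hx
    have h1 : ∫ y in (0 : ℝ)..L, s.dens n y = 1 := s.normU n
    have h2 : ∫ y in (0 : ℝ)..L, s.dens n y ≤
        ∫ _y in (0 : ℝ)..L, K * (s.dens n x + I n) :=
      sq_int_mono hL (s.cont_dens n) continuousOn_const (fun y hy => hH n x hx y hy)
    rw [h1, intervalIntegral.integral_const, smul_eq_mul, sub_zero] at h2
    have h3 : (L * K)⁻¹ ≤ s.dens n x + I n := by
      rw [inv_le_iff_one_le_mul₀ (by positivity)]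
      linarith
    linarith
  set Q := ∫ x in (0 : ℝ)..β, ‖qf β x‖ ^ 2 with hQ
  have hqc : Continuous (fun x => ‖qf β x‖ ^ 2) := (cont_qf β).norm.pow 2
  have hQ0 : 0 < Q := by
    apply intervalIntegral.intervalIntegral_pos_of_pos_on (hqc.intervalIntegrable 0 β) _ hb
    intro x hx
    have : qf β x ≠ 0 := by
      unfold qf
      refine mul_ne_zero (by exact_mod_cast hx.1.ne') ?_
      rw [← Complex.ofReal_sub]
      exact_mod_cast (sub_pos.mpr hx.2).ne'
    positivity
  have hlow : ∀ n, ((L * K)⁻¹ - I n) * Q ≤ ∫ x in (0 : ℝ)..β, ‖qf β x‖ ^ 2 * s.dens n x := by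
    intro n
    rw [hQ, ← intervalIntegral.integral_const_mul]
    apply sq_int_mono hb (continuousOn_const.mul hqc.continuousOn)
      (hqc.continuousOn.mul ((s.cont_dens n).mono (Icc_subset_Icc_right hbL.le)))
    intro x hx
    have := low n x ⟨hx.1, hx.2.trans hbL.le⟩
    change ((L * K)⁻¹ - I n) * ‖qf β x‖ ^ 2 ≤ ‖qf β x‖ ^ 2 * s.dens n x
    rw [mul_comm]
    gcongr
  have lim := (hI0.const_sub (L * K)⁻¹).mul_const Q
  have := le_of_tendsto_of_tendsto' lim (s.loc_dens h) hlow
  rw [sub_zero] at this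
  have : 0 < (L * K)⁻¹ * Q := by positivity
  linarith

end BSys

/-- derivative up to the boundary -/
def Dv (L : ℝ) (f : ℝ → ℂ) : ℝ → ℂ := derivWithin f (Icc 0 L)

lemma cont_Dv {L : ℝ} (hL : 0 < L) {f : ℝ → ℂ} (hf : ContDiffOn ℝ 1 f (Icc 0 L)) :
    ContinuousOn (Dv L f) (Icc 0 L) :=
  hf.continuousOn_derivWithin (uniqueDiffOn_Icc hL) le_rfl

lemma Dv_eq {L : ℝ} (f : ℝ → ℂ) {x : ℝ} (hx : x ∈ Ioo 0 L) : Dv L f x = deriv f x :=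
  derivWithin_of_mem_nhds (Icc_mem_nhds hx.1 hx.2)

lemma hd_Dv {L : ℝ} {f : ℝ → ℂ} (hf : ContDiffOn ℝ 1 f (Icc 0 L)) {x : ℝ} (hx : x ∈ Ioo 0 L) :
    HasDerivAt f (Dv L f x) x := by
  rw [Dv_eq f hx]
  exact ((hf.differentiableOn one_ne_zero).differentiableAt
    (Icc_mem_nhds hx.1 hx.2)).hasDerivAt

lemma hd_deriv {p q : ℝ} {f : ℝ → ℂ} (hf : ContDiffOn ℝ 2 f (Icc p q)) {x : ℝ}
    (hx : x ∈ Ioo p q) : DifferentiableAt ℝ (deriv f) x := by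
  have h1 : ContDiffOn ℝ 1 (deriv f) (Ioo p q) :=
    (hf.mono Ioo_subset_Icc_self).deriv_of_isOpen isOpen_Ioo (by norm_num)
  exact (h1.differentiableOn one_ne_zero).differentiableAt (Ioo_mem_nhds hx.1 hx.2)

lemma ev_U {β L x : ℝ} (hx : x ∈ Ioo 0 β ∪ Ioo β L) :
    ∀ᶠ y in nhds x, y ∈ Ioo 0 β ∪ Ioo β L :=
  (isOpen_Ioo.union isOpen_Ioo).mem_nhds hx

/-- passage to the first order system -/
def BresseSetting.toSys {ρ₁ ρ₂ k₁ k₂ k₃ l L β a₀ : ℝ}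
    (b : BresseSetting ρ₁ ρ₂ k₁ k₂ k₃ l L β a₀ 4)
    (h : BSys.Pos ρ₁ ρ₂ k₁ k₂ k₃ l L β a₀) (M : ℕ) (hM : ∀ n, M ≤ n → 1 ≤ |b.lam n|) :
    BSys ρ₁ ρ₂ k₁ k₂ k₃ l L β a₀ := by
  have hL := h.pL
  have hsub : ∀ x, x ∈ Ioo (0 : ℝ) β ∪ Ioo β L → x ∈ Ioo 0 L := by
    rintro x (hx | hx)
    · exact ⟨hx.1, hx.2.trans h.bL⟩
    · exact ⟨h.b.trans hx.1, hx.2⟩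
  have hp : ∀ n, (b.lam n : ℂ) ^ (-((4 : ℕ) : ℤ)) = (b.lam n : ℂ)⁻¹ ^ 4 := by
    intro n
    rw [zpow_neg, zpow_natCast, inv_pow]
  have hk1 : (k₁ : ℂ) ≠ 0 := by exact_mod_cast h.k1.ne'
  have hk2 : (k₂ : ℂ) ≠ 0 := by exact_mod_cast h.k2.ne'
  have hk3 : (k₃ : ℂ) ≠ 0 := by exact_mod_cast h.k3.ne'
  have one_two : (1 : WithTop ℕ∞) ≤ 2 := by norm_num
  have ev2 : ∀ n, ∀ x ∈ Ioo (0 : ℝ) β ∪ Ioo β L, b.v2 n x =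
      Complex.I * b.lam n * b.v1 n x - (b.lam n : ℂ)⁻¹ ^ 4 * b.f1 n x := by
    intro n x hx
    have := b.eq1 n x hx
    rw [hp] at this
    linear_combination -this
  have ev4 : ∀ n, ∀ x ∈ Ioo (0 : ℝ) β ∪ Ioo β L, b.v4 n x =
      Complex.I * b.lam n * b.v3 n x - (b.lam n : ℂ)⁻¹ ^ 4 * b.f3 n x := by
    intro n x hx
    have := b.eq3 n x hx
    rw [hp] at this
    linear_combination -this
  have ev6 : ∀ n, ∀ x ∈ Ioo (0 : ℝ) β ∪ Ioo β L, b.v6 n x =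
      Complex.I * b.lam n * b.v5 n x - (b.lam n : ℂ)⁻¹ ^ 4 * b.f5 n x := by
    intro n x hx
    have := b.eq5 n x hx
    rw [hp] at this
    linear_combination -this
  have hder : ∀ {v w f : ℝ → ℂ} {c e : ℂ}, ContDiffOn ℝ 1 v (Icc 0 L) →
      ContDiffOn ℝ 1 f (Icc 0 L) →
      (∀ x ∈ Ioo (0 : ℝ) β ∪ Ioo β L, w x = c * v x - e * f x) →
      ∀ x ∈ Ioo (0 : ℝ) β ∪ Ioo β L, HasDerivAt w (c * Dv L v x - e * Dv L f x) x := by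
    intro v w f c e hv hf hw x hx
    refine (((hd_Dv hv (hsub x hx)).const_mul c).sub
      ((hd_Dv hf (hsub x hx)).const_mul e)).congr_of_eventuallyEq ?_
    exact (ev_U hx).mono hw
  have r1 : ∀ n, ContDiffOn ℝ 1 (b.v1 n) (Icc 0 L) := fun n => (b.reg_v1 n).of_le one_two
  have r3 : ∀ n, ContDiffOn ℝ 1 (b.v3 n) (Icc 0 L) := fun n => (b.reg_v3 n).of_le one_two
  have df : ∀ {f : ℝ → ℂ}, ContDiffOn ℝ 1 f (Icc 0 L) → ∀ x ∈ Ioo (0 : ℝ) β ∪ Ioo β L,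
      DifferentiableAt ℝ f x := fun hf x hx => (hd_Dv hf (hsub x hx)).differentiableAt
  refine
    { lam := fun n => b.lam (n + M)
      y1 := fun n => b.v2 (n + M)
      y2 := fun n => b.v4 (n + M)
      y3 := fun n => b.v6 (n + M)
      S := fun n x => Dv L (b.v1 (n + M)) x + b.v3 (n + M) x + l * b.v5 (n + M) x
      P := fun n => Dv L (b.v3 (n + M))
      N := fun n x => Dv L (b.v5 (n + M)) x - l * b.v1 (n + M) x
      G1 := fun n x => Dv L (b.f1 (n + M)) x + b.f3 (n + M) x + l * b.f5 (n + M) x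
      G2 := fun n => b.f2 (n + M)
      G3 := fun n => Dv L (b.f3 (n + M))
      G4 := fun n => b.f4 (n + M)
      G5 := fun n x => Dv L (b.f5 (n + M)) x - l * b.f1 (n + M) x
      G6 := fun n => b.f6 (n + M)
      lam_one := fun n => hM _ (Nat.le_add_left _ _)
      lam_tendsto := b.lam_tendsto.comp (tendsto_add_atTop_nat M)
      c_y1 := fun n => (b.reg_v2 _).continuousOn
      c_y2 := fun n => (b.reg_v4 _).continuousOn
      c_y3 := fun n => (b.reg_v6 _).continuousOn
      c_S := fun n => ((cont_Dv hL (r1 _)).add (r3 _).continuousOn).add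
        (continuousOn_const.mul (b.reg_v5 _).continuousOn)
      c_P := fun n => cont_Dv hL (r3 _)
      c_N := fun n => (cont_Dv hL (b.reg_v5 _)).sub (continuousOn_const.mul (r1 _).continuousOn)
      c_G1 := fun n => ((cont_Dv hL (b.reg_f1 _)).add (b.reg_f3 _).continuousOn).add
        (continuousOn_const.mul (b.reg_f5 _).continuousOn)
      c_G2 := fun n => b.reg_f2 _
      c_G3 := fun n => cont_Dv hL (b.reg_f3 _)
      c_G4 := fun n => b.reg_f4 _
      c_G5 := fun n => (cont_Dv hL (b.reg_f5 _)).sub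
        (continuousOn_const.mul (b.reg_f1 _).continuousOn)
      c_G6 := fun n => b.reg_f6 _
      d_y1 := ?_
      d_y2 := ?_
      d_y3 := ?_
      d_S := ?_
      d_P := ?_
      d_N := ?_
      bc0 := fun n => ⟨(b.bc_zero _).2.1, (b.bc_zero _).2.2.2.1, (b.bc_zero _).2.2.2.2.2.1⟩
      bcL := fun n => ⟨(b.bc_L _).2.1, (b.bc_L _).2.2.2.1, (b.bc_L _).2.2.2.2.2.1⟩
      normU := ?_
      normF := ?_ }
  · intro n x hx
    refine (hder (r1 _) (b.reg_f1 _) (ev2 _) x hx).congr_deriv ?_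
    rw [ev4 _ x hx, ev6 _ x hx]
    ring
  · intro n x hx
    exact hder (r3 _) (b.reg_f3 _) (ev4 _) x hx
  · intro n x hx
    refine (hder (b.reg_v5 _) (b.reg_f5 _) (ev6 _) x hx).congr_deriv ?_
    rw [ev2 _ x hx]
    ring
  · intro n x hx
    have e := b.eq2 (n + M) x hx
    rw [hp] at e
    have hdiff : DifferentiableAt ℝ
        (fun y => deriv (b.v1 (n + M)) y + b.v3 (n + M) y + (l : ℂ) * b.v5 (n + M) y) x :=
      ((hd_deriv (b.reg_v1 _) (hsub x hx)).add (df (r3 _) x hx)).add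
        ((df (b.reg_v5 _) x hx).const_mul _)
    have hd := hdiff.hasDerivAt.congr_of_eventuallyEq
      (f₁ := fun x => Dv L (b.v1 (n + M)) x + b.v3 (n + M) x + l * b.v5 (n + M) x)
      ((ev_U hx).mono fun y hy => by
        change _ = deriv (b.v1 (n + M)) y + b.v3 (n + M) y + (l : ℂ) * b.v5 (n + M) y
        rw [← Dv_eq (L := L) _ (hsub y hy)])
    refine hd.congr_deriv ?_
    rw [← Dv_eq (L := L) (b.v5 (n + M)) (hsub x hx)] at e
    rw [eq_div_iff hk1]
    linear_combination -e
  · intro n x hx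
    have e := b.eq4 (n + M) x hx
    rw [hp] at e
    have hd := (hd_deriv (b.reg_v3 (n + M)) (hsub x hx)).hasDerivAt.congr_of_eventuallyEq
      (f₁ := Dv L (b.v3 (n + M)))
      ((ev_U hx).mono fun y hy => Dv_eq _ (hsub y hy))
    refine hd.congr_deriv ?_
    rw [← Dv_eq (L := L) (b.v1 (n + M)) (hsub x hx)] at e
    rw [eq_div_iff hk2]
    linear_combination -e
  · intro n x hx
    have e := b.eq6 (n + M) x hx
    rw [hp] at e
    have hd5 : DifferentiableAt ℝ (deriv (b.v5 (n + M))) x := by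
      rcases hx with hx | hx
      · exact hd_deriv (b.reg_v5_left _) hx
      · exact hd_deriv (b.reg_v5_right _) hx
    have hdiff : DifferentiableAt ℝ
        (fun y => deriv (b.v5 (n + M)) y - (l : ℂ) * b.v1 (n + M) y) x :=
      hd5.sub ((df (r1 _) x hx).const_mul _)
    have hd := hdiff.hasDerivAt.congr_of_eventuallyEq
      (f₁ := fun x => Dv L (b.v5 (n + M)) x - l * b.v1 (n + M) x)
      ((ev_U hx).mono fun y hy => by
        change _ = deriv (b.v5 (n + M)) y - (l : ℂ) * b.v1 (n + M) y
        rw [← Dv_eq (L := L) _ (hsub y hy)])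
    refine hd.congr_deriv ?_
    rw [← Dv_eq (L := L) (b.v1 (n + M)) (hsub x hx)] at e
    rw [eq_div_iff hk3]
    linear_combination -e
  · intro n
    rw [← b.normU (n + M)]
    apply intervalIntegral.integral_congr_Ioo_of_le hL.le
    intro x hx
    simp only [Dv_eq _ hx]
  · refine (b.normF.comp (tendsto_add_atTop_nat M)).congr fun n => ?_
    apply intervalIntegral.integral_congr_Ioo_of_le hL.le
    intro x hx
    simp only [Dv_eq _ hx]

/-- Frequency-domain criterion ‖(iλ−𝒜)⁻¹‖ = O(λ⁴): no resolvent sequence with ℓ = 4 exists. -/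
theorem bresse_polynomial_stability_criterion_neq (ρ₁ ρ₂ k₁ k₂ k₃ l L β a₀ : ℝ)
    (hrho1 : 0 < ρ₁) (hrho2 : 0 < ρ₂) (hk1 : 0 < k₁) (hk2 : 0 < k₂) (hk3 : 0 < k₃)
    (hl : 0 < l) (hL : 0 < L) (ha0 : 0 < a₀) (hbeta : 0 < β) (hbetaL : β < L)
    (hspeed : k₁ / ρ₁ ≠ k₂ / ρ₂) :
    IsEmpty (BresseSetting ρ₁ ρ₂ k₁ k₂ k₃ l L β a₀ 4) := by
  have h : BSys.Pos ρ₁ ρ₂ k₁ k₂ k₃ l L β a₀ :=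
    ⟨hrho1, hrho2, hk1, hk2, hk3, hl, hL, ha0, hbeta, hbetaL⟩
  refine ⟨fun b => ?_⟩
  obtain ⟨M, hM⟩ := Filter.eventually_atTop.mp (b.lam_tendsto.eventually_ge_atTop 1)
  exact (b.toSys h M hM).contra h
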